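/- Matrix form of Proposition 3.3: Let b ≥ 1, let β = (β_1,…,β_b) ∈ {0,1}^b with β_1+⋯+β_b even, let N_k = 2n_k ≥ 4 be even for 1 ≤ k ≤ b, let m ≥ 0 be such that V := N_1+⋯+N_b+m is even, let R be a commutative ring, let y^k_1,…,y^k_{N_k} ∈ R for each k, and let W be an arbitrary skew-symmetric V×V matrix over R whose indices are grouped into consecutive blocks I_1,…,I_b of sizes N_1,…,N_b (the circuits) followed by a block of size m (the interior). For each k, if β_k = 0 define the N_k×N_k matrix A^k by a_{1,1} = -y^k_1, a_{1,N_k} = y^k_1, a_{i,i-1} = a_{i,i} = (-1)^i y^k_i for 2 ≤ i ≤ N_k, all other entries 0, and the skew-symmetric N_k×N_k matrix B^k by b_{i,i+1} = -1 = -b_{i+1,i} for 1 ≤ i ≤ N_k-1, b_{1,N_k} = -1 = -b_{N_k,1}, all other entries 0; if β_k = 1 define the N_k×(N_k+1) matrix A^k by the same formulas except a_{1,N_k} = -y^k_1 and an all-zero last column, and the skew-symmetric (N_k+1)×(N_k+1) matrix B^k by b_{i,i+1} = -1 = -b_{i+1,i} for 1 ≤ i ≤ N_k-1, b_{1,N_k}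 = 1 = -b_{N_k,1}, b_{i,N_k+1} = (-1)^i = -b_{N_k+1,i} for 1 ≤ i ≤ N_k, all other entries 0. Let A_β be the skew-symmetric matrix of size V + Σ_k (N_k+β_k) obtained from W by inserting immediately after each block I_k a new block J_k of N_k+β_k indices, with block between I_k and J_k equal to A^k, block within J_k equal to B^k, all entries between J_k and indices outside I_k ∪ J_k equal to 0, and all entries among the original V indices equal to those of W. Let M_β be the skew-symmetric matrix of size V + Σ_k β_k obtained from W by inserting immediately after each block I_k with β_k = 1 one new index (the virtual vertex of circuit k, of weight 1), and adding to the entry in position (i,j), i < j, the correction term (-1)^{i+j} y_i y_j whenever the positions i and j both belong to the same circuit k (the virtual vertex of circuit k counting as belonging to circuit k), where y_i denotes the weight of the circuit vertex or virtual vertex at position i; entries with i or j in the interior, or with i and j in different circuits, receive no correction. Then Pf(A_β) = (-1)^{n_1+⋯+n_b} · 2^{#{k : β_k = 0}} · (Π_{k : β_k = 1} N_k) · Pf(M_β). -/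

import Mathlib

open Matrix

/-- The Pfaffian of a matrix indexed by `Fin m` (intended for even `m`), defined as the
sum over all partitions of the index set into pairs (encoded by their canonical
representative permutations `σ`, sending the positions `2k, 2k+1` to the pair `(i_k, j_k)`
with `i_k < j_k` and `i_1 < i_2 < ⋯`) of the sign of `σ` times the product of the
corresponding entries. -/
def pf {R : Type*} [CommRing R] {m : ℕ} (A : Matrix (Fin m) (Fin m) R) : R :=
  ∑ σ ∈ Finset.univ.filter (fun σ : Equiv.Perm (Fin m) =>
      (∀ k : Fin (m / 2), σ ⟨2 * k.1, by have := k.2; omega⟩ < σ ⟨2 * k.1 + 1, by have := k.2; omega⟩) ∧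
      (∀ k l : Fin (m / 2), k < l →
        σ ⟨2 * k.1, by have := k.2; omega⟩ < σ ⟨2 * l.1, by have := l.2; omega⟩)),
    (Equiv.Perm.sign σ : ℤ) • ∏ k : Fin (m / 2),
      A (σ ⟨2 * k.1, by have := k.2; omega⟩) (σ ⟨2 * k.1 + 1, by have := k.2; omega⟩)

/-- Splitting off the first summand of a sigma type over `Fin (b+1)`. -/
def sigmaSuccEquiv {b : ℕ} (f : Fin (b + 1) → ℕ) :
    (Σ k : Fin (b + 1), Fin (f k)) ≃ (Fin (f 0) ⊕ Σ k : Fin b, Fin (f k.succ)) where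
  toFun p :=
    if h : p.1 = 0 then Sum.inl (Fin.cast (congrArg f h) p.2)
    else Sum.inr ⟨p.1.pred h, Fin.cast (congrArg f (Fin.succ_pred p.1 h).symm) p.2⟩
  invFun q :=
    match q with
    | Sum.inl j => ⟨0, j⟩
    | Sum.inr ⟨k, j⟩ => ⟨k.succ, j⟩
  left_inv := by
    rintro ⟨k, j⟩
    by_cases h : k = 0
    · subst h; simp
    · simp only [h, dif_neg, not_false_iff]
      apply Sigma.ext
      · simp [Fin.succ_pred]
      · rw [Fin.heq_ext_iff (congrArg f (Fin.succ_pred k h))]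
        simp
  right_inv := by
    rintro (j | ⟨k, j⟩)
    · simp
    · simp [Fin.succ_ne_zero]

/-- The order-preserving equivalence between a sigma of `Fin`s over `Fin b` and `Fin` of
the total sum: `⟨k, j⟩` is sent to `(∑_{l < k} f l) + j`, so that the blocks are placed
consecutively, in order. -/
def mySigmaEquiv : ∀ {b : ℕ} (f : Fin b → ℕ), (Σ k : Fin b, Fin (f k)) ≃ Fin (∑ k, f k)
  | 0, f =>
      ⟨fun p => p.1.elim0, fun i => absurd i.2 (by simp), fun p => p.1.elim0,
        fun i => absurd i.2 (by simp)⟩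
  | b + 1, f =>
      (sigmaSuccEquiv f).trans
        ((Equiv.sumCongr (Equiv.refl (Fin (f 0))) (mySigmaEquiv (fun k => f k.succ))).trans
          (finSumFinEquiv.trans (finCongr (Fin.sum_univ_succ f).symm)))

/-- The raw entries of the blade-edge block `A^k` of a circuit of length `N` (1-based
description, here 0-based): `a_{1,1} = -y_1`; `a_{1,N} = y_1` if `β_k = 0` and
`a_{1,N} = -y_1` if `β_k = 1`; `a_{i,i-1} = a_{i,i} = (-1)^i y_i` for `2 ≤ i ≤ N`;
all other entries (in particular the whole last column when `β_k = 1`) are `0`. -/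
def AblkE {R : Type*} [CommRing R] (N : ℕ) (c : Bool) (y : Fin N → R) (i j : ℕ) : R :=
  if hi : i < N then
    (if i = 0 then
      (if j = 0 then -y ⟨i, hi⟩
       else if j = N - 1 then cond c (-y ⟨i, hi⟩) (y ⟨i, hi⟩) else 0)
     else if j + 1 = i ∨ j = i then (-1 : R) ^ (i + 1) * y ⟨i, hi⟩ else 0)
  else 0

/-- The raw entries of the inner block `B^k` of a circuit of length `N` (1-based
description): `b_{i,i+1} = -1 = -b_{i+1,i}` for `1 ≤ i ≤ N-1`; `b_{1,N} = -1 = -b_{N,1}`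
if `β_k = 0` and `b_{1,N} = 1 = -b_{N,1}` if `β_k = 1`; when `β_k = 1` moreover
`b_{i,N+1} = (-1)^i = -b_{N+1,i}` for `1 ≤ i ≤ N`; all other entries are `0`. -/
def BblkE {R : Type*} [CommRing R] (N : ℕ) (c : Bool) (i j : ℕ) : R :=
  if i + 1 = j ∧ j ≤ N - 1 then -1
  else if j + 1 = i ∧ i ≤ N - 1 then 1
  else if i = 0 ∧ j = N - 1 then cond c 1 (-1)
  else if j = 0 ∧ i = N - 1 then cond c (-1) 1
  else if j = N ∧ i ≤ N - 1 then (-1 : R) ^ (i + 1)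
  else if i = N ∧ j ≤ N - 1 then -(-1 : R) ^ (j + 1)
  else 0

/-- The weight of the (0-based) position `i` in a circuit block of size `N + β_k`:
the vertex weight `y_i` for `i < N`, and `1` for the virtual vertex (position `N`,
present when `β_k = 1`). -/
def vW {R : Type*} [CommRing R] (N : ℕ) (y : Fin N → R) (i : ℕ) : R :=
  if h : i < N then y ⟨i, h⟩ else 1

/-- The skew-symmetric same-circuit correction term: `(-1)^{i+j} y_i y_j` for positions
`i < j` within the circuit block (extended skew-symmetrically); the parity of the sum of
the two local positions agrees with that of the global positions. -/
def corrE {R : Type*} [CommRing R] (N : ℕ) (y : Fin N → R) (i j : ℕ) : R :=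
  if i < j then (-1 : R) ^ (i + j) * vW N y i * vW N y j
  else if j < i then -((-1 : R) ^ (i + j) * vW N y i * vW N y j)
  else 0

/-- The big matrix `A_β`, indexed by the circuit blocks `I_k` (`Sum.inl ⟨k, Sum.inl i⟩`),
the inserted inner blocks `J_k` of size `N_k + β_k` (`Sum.inl ⟨k, Sum.inr i⟩`) and the
interior block (`Sum.inr t`): among the original indices it agrees with `W`; the block
between `I_k` and `J_k` is `A^k` (and its negative transpose); the block within `J_k`
is `B^k`; all entries between `J_k` and indices outside `I_k ∪ J_k` are `0`. -/
def bigA {R : Type*} [CommRing R] (b m : ℕ) (N : Fin b → ℕ) (β : Fin b → Bool)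
    (y : (k : Fin b) → Fin (N k) → R)
    (W : Matrix ((Σ k : Fin b, Fin (N k)) ⊕ Fin m) ((Σ k : Fin b, Fin (N k)) ⊕ Fin m) R) :
    Matrix ((Σ k : Fin b, Fin (N k) ⊕ Fin (N k + cond (β k) 1 0)) ⊕ Fin m)
           ((Σ k : Fin b, Fin (N k) ⊕ Fin (N k + cond (β k) 1 0)) ⊕ Fin m) R := fun p q =>
  match p, q with
  | Sum.inl ⟨k, Sum.inl i⟩, Sum.inl ⟨l, Sum.inl j⟩ => W (Sum.inl ⟨k, i⟩) (Sum.inl ⟨l, j⟩)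
  | Sum.inl ⟨k, Sum.inl i⟩, Sum.inl ⟨l, Sum.inr j⟩ =>
      if k = l then AblkE (N k) (β k) (y k) i.1 j.1 else 0
  | Sum.inl ⟨k, Sum.inr i⟩, Sum.inl ⟨l, Sum.inl j⟩ =>
      if k = l then -AblkE (N k) (β k) (y k) j.1 i.1 else 0
  | Sum.inl ⟨k, Sum.inr i⟩, Sum.inl ⟨l, Sum.inr j⟩ =>
      if k = l then BblkE (N k) (β k) i.1 j.1 else 0
  | Sum.inl ⟨k, Sum.inl i⟩, Sum.inr t => W (Sum.inl ⟨k, i⟩) (Sum.inr t)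
  | Sum.inl ⟨_, Sum.inr _⟩, Sum.inr _ => 0
  | Sum.inr t, Sum.inl ⟨k, Sum.inl i⟩ => W (Sum.inr t) (Sum.inl ⟨k, i⟩)
  | Sum.inr _, Sum.inl ⟨_, Sum.inr _⟩ => 0
  | Sum.inr s, Sum.inr t => W (Sum.inr s) (Sum.inr t)

/-- The modified matrix `M_β`, indexed by the circuit blocks enlarged by one virtual
vertex when `β_k = 1` (`Sum.inl ⟨k, i⟩`, the virtual vertex being the last position) and
the interior block (`Sum.inr t`): among the original indices it is `W` plus the
same-circuit correction `(-1)^{i+j} y_i y_j` for `i < j` (the virtual vertex of circuit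
`k` counting as belonging to circuit `k`, with weight `1`); entries with an index in the
interior or in a different circuit receive no correction, and all other entries involving
a virtual vertex are `0`. -/
def bigM {R : Type*} [CommRing R] (b m : ℕ) (N : Fin b → ℕ) (β : Fin b → Bool)
    (y : (k : Fin b) → Fin (N k) → R)
    (W : Matrix ((Σ k : Fin b, Fin (N k)) ⊕ Fin m) ((Σ k : Fin b, Fin (N k)) ⊕ Fin m) R) :
    Matrix ((Σ k : Fin b, Fin (N k + cond (β k) 1 0)) ⊕ Fin m)
           ((Σ k : Fin b, Fin (N k + cond (β k) 1 0)) ⊕ Fin m) R := fun p q =>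
  match p, q with
  | Sum.inl ⟨k, i⟩, Sum.inl ⟨l, j⟩ =>
      (if hi : i.1 < N k then if hj : j.1 < N l then
          W (Sum.inl ⟨k, ⟨i.1, hi⟩⟩) (Sum.inl ⟨l, ⟨j.1, hj⟩⟩) else 0 else 0)
        + (if k = l then corrE (N k) (y k) i.1 j.1 else 0)
  | Sum.inl ⟨k, i⟩, Sum.inr t =>
      if hi : i.1 < N k then W (Sum.inl ⟨k, ⟨i.1, hi⟩⟩) (Sum.inr t) else 0
  | Sum.inr t, Sum.inl ⟨k, i⟩ =>
      if hi : i.1 < N k then W (Sum.inr t) (Sum.inl ⟨k, ⟨i.1, hi⟩⟩) else 0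
  | Sum.inr s, Sum.inr t => W (Sum.inr s) (Sum.inr t)

section Pfaffian

variable {R : Type*} [CommRing R] {m : ℕ}

/-- The first position of the `k`-th pair of positions in `Fin m`. -/
def pairFst (k : Fin (m / 2)) : Fin m := ⟨2 * k.1, by have := k.2; omega⟩

/-- The second position of the `k`-th pair of positions in `Fin m`. -/
def pairSnd (k : Fin (m / 2)) : Fin m := ⟨2 * k.1 + 1, by have := k.2; omega⟩

/-- Permutations that are the canonical representatives of the partitions into pairs. -/
def IsPairing (σ : Equiv.Perm (Fin m)) : Prop :=
  (∀ k, σ (pairFst k) < σ (pairSnd k)) ∧ ∀ k l : Fin (m / 2), k < l → σ (pairFst k) < σ (pairFst l)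

instance : DecidablePred (IsPairing (m := m)) := fun σ => by
  unfold IsPairing; infer_instance

/-- The summand of the Pfaffian attached to a permutation. -/
def pfTerm (A : Matrix (Fin m) (Fin m) R) (σ : Equiv.Perm (Fin m)) : R :=
  (Equiv.Perm.sign σ : ℤ) • ∏ k : Fin (m / 2), A (σ (pairFst k)) (σ (pairSnd k))

theorem pf_eq_sum_pfTerm (A : Matrix (Fin m) (Fin m) R) :
    pf A = ∑ σ with IsPairing σ, pfTerm A σ := by
  unfold pf pfTerm
  refine Finset.sum_congr ?_ fun _ _ => rfl
  ext σ
  rw [Finset.mem_filter, Finset.mem_filter]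
  rfl

/-- Positions in `Fin m`, for `m` even, as pairs with a choice of a member. -/
def pairEquiv (hm : Even m) : Fin (m / 2) × Fin 2 ≃ Fin m :=
  finProdFinEquiv.trans (finCongr (Nat.div_mul_cancel hm.two_dvd))

@[simp]
theorem pairEquiv_zero (hm : Even m) (k : Fin (m / 2)) : pairEquiv hm (k, 0) = pairFst k := by
  ext; simp [pairEquiv, pairFst]

@[simp]
theorem pairEquiv_one (hm : Even m) (k : Fin (m / 2)) : pairEquiv hm (k, 1) = pairSnd k := by
  ext; simp [pairEquiv, pairSnd]; omega

theorem prod_eq_prod_pairs (hm : Even m) (f : Fin m → R) :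
    ∏ i, f i = ∏ k : Fin (m / 2), f (pairFst k) * f (pairSnd k) := by
  rw [← (pairEquiv hm).prod_comp, Fintype.prod_prod_type]
  simp [Fin.prod_univ_two]

/-- The permutation of `Fin m` permuting the pairs of positions by `π` and permuting the
members of the `k`-th pair by `ε k`. -/
def pairPerm (hm : Even m) (π : Equiv.Perm (Fin (m / 2)))
    (ε : Fin (m / 2) → Equiv.Perm (Fin 2)) : Equiv.Perm (Fin m) :=
  (pairEquiv hm).permCongr
    ((Equiv.prodCongrLeft fun _ : Fin 2 => π) * Equiv.prodCongrRight ε)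

theorem pairPerm_apply (hm : Even m) (π : Equiv.Perm (Fin (m / 2)))
    (ε : Fin (m / 2) → Equiv.Perm (Fin 2)) (k : Fin (m / 2)) (a : Fin 2) :
    pairPerm hm π ε (pairEquiv hm (k, a)) = pairEquiv hm (π k, ε k a) := by
  simp [pairPerm, Equiv.permCongr_apply]

theorem sign_pairPerm (hm : Even m) (π : Equiv.Perm (Fin (m / 2)))
    (ε : Fin (m / 2) → Equiv.Perm (Fin 2)) :
    Equiv.Perm.sign (pairPerm hm π ε) = ∏ k, Equiv.Perm.sign (ε k) := by
  rw [pairPerm, Equiv.Perm.sign_permCongr, Equiv.Perm.sign_mul, Equiv.Perm.sign_prodCongrLeft,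
    Equiv.Perm.sign_prodCongrRight]
  simp

theorem perm_fin_two (p : Equiv.Perm (Fin 2)) : p = 1 ∨ p = Equiv.swap 0 1 := by
  revert p; decide

theorem pfTerm_mul_pairPerm (hm : Even m) (A : Matrix (Fin m) (Fin m) R)
    (hA : ∀ i j, A i j = -A j i) (σ : Equiv.Perm (Fin m)) (π : Equiv.Perm (Fin (m / 2)))
    (ε : Fin (m / 2) → Equiv.Perm (Fin 2)) :
    pfTerm A (σ * pairPerm hm π ε) = pfTerm A σ := by
  have key : ∀ k, A ((σ * pairPerm hm π ε) (pairFst k)) ((σ * pairPerm hm π ε) (pairSnd k)) =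
      ((Equiv.Perm.sign (ε k) : ℤ) : R) * A (σ (pairFst (π k))) (σ (pairSnd (π k))) := by
    intro k
    rw [← pairEquiv_zero hm, ← pairEquiv_one hm, Equiv.Perm.mul_apply, Equiv.Perm.mul_apply,
      pairPerm_apply, pairPerm_apply]
    rcases perm_fin_two (ε k) with h | h
    · simp [h]
    · rw [h]; simp; rw [hA]
  have hs : ((∏ k, ((Equiv.Perm.sign (ε k) : ℤ) : R)) *
      ∏ k, ((Equiv.Perm.sign (ε k) : ℤ) : R)) = 1 := by
    rw [← Finset.prod_mul_distrib]
    refine Finset.prod_eq_one fun k _ => ?_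
    rcases Int.units_eq_one_or (Equiv.Perm.sign (ε k)) with h | h <;> simp [h]
  unfold pfTerm
  rw [Finset.prod_congr rfl fun k _ => key k, Finset.prod_mul_distrib,
    Equiv.prod_comp π fun k => A (σ (pairFst k)) (σ (pairSnd k)), Equiv.Perm.sign_mul,
    sign_pairPerm]
  simp only [zsmul_eq_mul, Units.val_mul, Units.coe_prod, Int.cast_mul, Int.cast_prod]
  linear_combination (((Equiv.Perm.sign σ : ℤ) : R) *
    ∏ k, A (σ (pairFst k)) (σ (pairSnd k))) * hs

theorem IsPairing.strictMono {σ : Equiv.Perm (Fin m)} (h : IsPairing σ) :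
    StrictMono fun k => σ (pairFst k) := fun k l => h.2 k l

theorem pairing_mul_pairPerm_bijective (hm : Even m) :
    Function.Bijective fun x : {σ : Equiv.Perm (Fin m) // IsPairing σ} ×
      Equiv.Perm (Fin (m / 2)) × (Fin (m / 2) → Equiv.Perm (Fin 2)) =>
        x.1.1 * pairPerm hm x.2.1 x.2.2 := by
  constructor
  · rintro ⟨⟨s, hs⟩, π, ε⟩ ⟨⟨t, ht⟩, ρ, δ⟩ h
    simp only at h
    have app : ∀ k a, s (pairEquiv hm (π k, ε k a)) = t (pairEquiv hm (ρ k, δ k a)) := by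
      intro k a
      have := congrArg (fun f : Equiv.Perm (Fin m) => f (pairEquiv hm (k, a))) h
      simpa [Equiv.Perm.mul_apply, pairPerm_apply] using this
    have both : ∀ k, s (pairFst (π k)) = t (pairFst (ρ k)) ∧
        s (pairSnd (π k)) = t (pairSnd (ρ k)) ∧ ε k = δ k := by
      intro k
      have h0 := app k 0
      have h1 := app k 1
      have hs' := hs.1 (π k)
      have ht' := ht.1 (ρ k)
      rcases perm_fin_two (ε k) with h | h <;> rcases perm_fin_two (δ k) with h' | h' <;>
        simp [h, h'] at h0 h1
      · exact ⟨h0, h1, by rw [h, h']⟩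
      · rw [h0, h1] at hs'; exact absurd hs' (lt_asymm ht')
      · rw [h0, h1] at hs'; exact absurd hs' (lt_asymm ht')
      · exact ⟨h1, h0, by rw [h, h']⟩
    have hr : (fun k => s (pairFst k)) = fun k => t (pairFst k) := by
      refine StrictMono.range_inj hs.strictMono ht.strictMono |>.1 ?_
      rw [← π.surjective.range_comp fun k => s (pairFst k),
        ← ρ.surjective.range_comp fun k => t (pairFst k)]
      congr 1
      funext k
      exact (both k).1
    have hπ : π = ρ := by
      ext1 k
      have := (both k).1
      rw [← congrFun hr (ρ k)] at this
      exact hs.strictMono.injective this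
    subst hπ
    have hst : s = t := by
      ext1 i
      obtain ⟨⟨k, a⟩, rfl⟩ := (pairEquiv hm).surjective i
      obtain ⟨k, rfl⟩ := π.surjective k
      fin_cases a
      · simpa using (both k).1
      · simpa using (both k).2.1
    subst hst
    have hε : ε = δ := funext fun k => (both k).2.2
    subst hε
    rfl
  · intro σ
    classical
    let ε : Fin (m / 2) → Equiv.Perm (Fin 2) := fun k =>
      if σ (pairFst k) < σ (pairSnd k) then 1 else Equiv.swap 0 1
    let τ := σ * pairPerm hm 1 ε
    have hτ : ∀ k, τ (pairFst k) < τ (pairSnd k) := by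
      intro k
      rw [← pairEquiv_zero hm, ← pairEquiv_one hm]
      simp only [τ, Equiv.Perm.mul_apply, pairPerm_apply, ε]
      split_ifs with h
      · simpa using h
      · have : σ (pairFst k) ≠ σ (pairSnd k) := by
          intro e
          have := congrArg Fin.val (σ.injective e)
          simp [pairFst, pairSnd] at this
        simpa using lt_of_le_of_ne (not_lt.1 h) this.symm
    let a : Fin (m / 2) → Fin m := fun k => τ (pairFst k)
    have ha : Function.Injective a := by
      intro k l h
      have := congrArg Fin.val (τ.injective h)
      simp only [pairFst] at this
      ext; omega
    let π := Tuple.sort a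
    have hπ : StrictMono (a ∘ π) :=
      (Tuple.monotone_sort a).strictMono_of_injective (ha.comp π.injective)
    have hmul : ∀ (k : Fin (m / 2)) (b : Fin 2),
        (τ * pairPerm hm π 1) (pairEquiv hm (k, b)) = τ (pairEquiv hm (π k, b)) := by
      intro k b
      rw [Equiv.Perm.mul_apply, pairPerm_apply]; rfl
    refine ⟨⟨⟨τ * pairPerm hm π 1, ?_, ?_⟩, π⁻¹, fun k => (ε k)⁻¹⟩, ?_⟩
    · intro k
      rw [← pairEquiv_zero hm, ← pairEquiv_one hm, hmul, hmul]
      simpa using hτ (π k)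
    · intro k l h
      rw [← pairEquiv_zero hm, ← pairEquiv_zero hm, hmul, hmul]
      simpa using hπ h
    · ext1 i
      obtain ⟨⟨k, b⟩, rfl⟩ := (pairEquiv hm).surjective i
      simp only [Equiv.Perm.mul_apply, pairPerm_apply, τ]
      simp

/-- The sum over all permutations that equals a multiple of the Pfaffian for skew-symmetric
matrices. -/
def pfSum (A : Matrix (Fin m) (Fin m) R) : R := ∑ σ, pfTerm A σ

theorem pfSum_eq (hm : Even m) (A : Matrix (Fin m) (Fin m) R) (hA : ∀ i j, A i j = -A j i) :
    pfSum A = Fintype.card (Equiv.Perm (Fin (m / 2)) × (Fin (m / 2) → Equiv.Perm (Fin 2))) *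
      pf A := by
  rw [pfSum, ← (Equiv.ofBijective _ (pairing_mul_pairPerm_bijective hm)).sum_comp,
    Fintype.sum_prod_type, pf_eq_sum_pfTerm, ← Finset.sum_subtype_eq_sum_filter, Finset.mul_sum]
  simp only [Equiv.ofBijective_apply, pfTerm_mul_pairPerm hm A hA, Finset.sum_const,
    Finset.card_univ, nsmul_eq_mul, Finset.subtype_univ]

theorem pfSum_submatrix_perm (A : Matrix (Fin m) (Fin m) R) (τ : Equiv.Perm (Fin m)) :
    pfSum (A.submatrix τ τ) = ((Equiv.Perm.sign τ : ℤ) : R) * pfSum A := by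
  rw [pfSum, pfSum, ← Equiv.sum_comp (Equiv.mulLeft τ⁻¹), Finset.mul_sum]
  refine Finset.sum_congr rfl fun σ _ => ?_
  simp only [pfTerm, Equiv.coe_mulLeft, Equiv.Perm.sign_mul, Equiv.Perm.sign_symm,
    Matrix.submatrix_apply, Equiv.Perm.mul_apply, Equiv.Perm.inv_def, Equiv.apply_symm_apply,
    zsmul_eq_mul]
  push_cast; ring

theorem pfSum_congruence (hm : Even m) (C A : Matrix (Fin m) (Fin m) R) :
    pfSum (C * A * Cᵀ) = C.det * pfSum A := by
  have expand : ∀ σ : Equiv.Perm (Fin m), pfTerm (C * A * Cᵀ) σ =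
      ∑ f : Fin m → Fin m, ((Equiv.Perm.sign σ : ℤ) : R) *
        ((∏ i, C (σ i) (f i)) * ∏ k : Fin (m / 2), A (f (pairFst k)) (f (pairSnd k))) := by
    intro σ
    have entry : ∀ i j, (C * A * Cᵀ) i j = ∑ p : Fin m × Fin m, C i p.1 * C j p.2 * A p.1 p.2 := by
      intro i j
      rw [Fintype.sum_prod_type, Finset.sum_comm]
      simp only [Matrix.mul_apply, Matrix.transpose_apply, Finset.sum_mul]
      refine Finset.sum_congr rfl fun _ _ => Finset.sum_congr rfl fun _ _ => by ring
    simp only [pfTerm, entry, zsmul_eq_mul, Finset.prod_univ_sum, Fintype.piFinset_univ,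
      Finset.mul_sum]
    let e : (Fin m → Fin m) ≃ (Fin (m / 2) → Fin m × Fin m) :=
      ((Equiv.arrowCongr (pairEquiv hm).symm (Equiv.refl _)).trans (Equiv.curry _ _ _)).trans
        (Equiv.arrowCongr (Equiv.refl _) (finTwoArrowEquiv _))
    have he : ∀ f k, e f k = (f (pairFst k), f (pairSnd k)) := by
      intro f k
      rw [← pairEquiv_zero hm, ← pairEquiv_one hm]
      rfl
    rw [← e.sum_comp]
    refine Finset.sum_congr rfl fun f _ => ?_
    simp only [he, prod_eq_prod_pairs hm, Finset.prod_mul_distrib]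
  have detf : ∀ f : Fin m → Fin m,
      ∑ σ : Equiv.Perm (Fin m), ((Equiv.Perm.sign σ : ℤ) : R) * ∏ i, C (σ i) (f i) =
        (C.submatrix id f).det := fun f => by
    rw [Matrix.det_apply']; rfl
  have h1 : pfSum (C * A * Cᵀ) = ∑ f : Fin m → Fin m, (C.submatrix id f).det *
      ∏ k : Fin (m / 2), A (f (pairFst k)) (f (pairSnd k)) := by
    simp only [pfSum, expand]
    rw [Finset.sum_comm]
    refine Finset.sum_congr rfl fun f _ => ?_
    rw [← detf, Finset.sum_mul]
    exact Finset.sum_congr rfl fun _ _ => by ring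
  rw [h1, ← Finset.sum_subset (Finset.subset_univ
    (Finset.univ.filter fun f : Fin m → Fin m => Function.Bijective f))]
  · rw [pfSum, Finset.mul_sum]
    symm
    refine Finset.sum_bij (fun σ _ => (σ : Fin m → Fin m))
      (fun σ _ => Finset.mem_filter.2 ⟨Finset.mem_univ _, σ.bijective⟩)
      (fun σ _ τ _ h => Equiv.coe_fn_injective h)
      (fun f hf => ⟨Equiv.ofBijective f (by simpa using hf), Finset.mem_univ _, rfl⟩) ?_
    intro σ _
    rw [Matrix.det_permute', pfTerm, zsmul_eq_mul]
    ring
  · intro f _ hf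
    have : ¬ Function.Injective f := fun h => hf (by
      simpa using Finite.injective_iff_bijective.1 h)
    simp only [Function.Injective, not_forall] at this
    obtain ⟨i, j, hij, hne⟩ := this
    rw [Matrix.det_zero_of_column_eq hne fun k => by simp [hij], zero_mul]

variable [IsDomain R] [CharZero R]

theorem pf_congruence (hm : Even m) (C A : Matrix (Fin m) (Fin m) R)
    (hA : ∀ i j, A i j = -A j i) : pf (C * A * Cᵀ) = C.det * pf A := by
  have hA' : Aᵀ = -A := by ext i j; simpa using hA j i
  have hC : ∀ i j, (C * A * Cᵀ) i j = -(C * A * Cᵀ) j i := by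
    intro i j
    have : (C * A * Cᵀ)ᵀ = -(C * A * Cᵀ) := by
      simp [Matrix.transpose_mul, hA', Matrix.mul_assoc]
    simpa using congrFun (congrFun this j) i
  have h := pfSum_congruence hm C A
  rw [pfSum_eq hm _ hC, pfSum_eq hm _ hA] at h
  refine mul_left_cancel₀ (Nat.cast_ne_zero.2 Fintype.card_ne_zero) (h.trans ?_)
  ring

theorem pf_submatrix_perm (hm : Even m) (A : Matrix (Fin m) (Fin m) R)
    (hA : ∀ i j, A i j = -A j i) (τ : Equiv.Perm (Fin m)) :
    pf (A.submatrix τ τ) = ((Equiv.Perm.sign τ : ℤ) : R) * pf A := by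
  have h := pfSum_submatrix_perm A τ
  rw [pfSum_eq hm (A.submatrix τ τ) fun i j => hA _ _, pfSum_eq hm A hA] at h
  refine mul_left_cancel₀ (Nat.cast_ne_zero.2 Fintype.card_ne_zero) (h.trans ?_)
  ring

end Pfaffian

section PfaffianExpansion

variable {R : Type*} [CommRing R] {m : ℕ}

/-- Extend a permutation of `Fin m` to `Fin (m + 2)` by fixing the last two elements. -/
def extendPerm (τ : Equiv.Perm (Fin m)) : Equiv.Perm (Fin (m + 2)) :=
  finSumFinEquiv.permCongr (Equiv.Perm.sumCongr τ (1 : Equiv.Perm (Fin 2)))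

theorem extendPerm_castAdd (τ : Equiv.Perm (Fin m)) (i : Fin m) :
    extendPerm τ (Fin.castAdd 2 i) = Fin.castAdd 2 (τ i) := by
  simp [extendPerm, Equiv.permCongr_apply]

theorem extendPerm_natAdd (τ : Equiv.Perm (Fin m)) (a : Fin 2) :
    extendPerm τ (Fin.natAdd m a) = Fin.natAdd m a := by
  simp [extendPerm, Equiv.permCongr_apply]

theorem sign_extendPerm (τ : Equiv.Perm (Fin m)) :
    Equiv.Perm.sign (extendPerm τ) = Equiv.Perm.sign τ := by
  rw [extendPerm, Equiv.Perm.sign_permCongr, Equiv.Perm.sign_sumCongr]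
  simp

theorem exists_extendPerm_eq {σ : Equiv.Perm (Fin (m + 2))}
    (h : ∀ a : Fin 2, σ (Fin.natAdd m a) = Fin.natAdd m a) : ∃ τ, extendPerm τ = σ := by
  let σ' : Equiv.Perm (Fin m ⊕ Fin 2) := finSumFinEquiv.symm.permCongr σ
  have hr : ∀ a, σ' (Sum.inr a) = Sum.inr a := fun a => by
    simp [σ', Equiv.permCongr_apply, h]
  have hmaps : Set.MapsTo σ' (Set.range Sum.inl) (Set.range Sum.inl) := by
    rintro _ ⟨i, rfl⟩
    rcases hi : σ' (Sum.inl i) with j | a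
    · exact ⟨j, rfl⟩
    · rw [← hr a] at hi
      simpa using σ'.injective hi
  obtain ⟨⟨τ, ρ⟩, hτ⟩ := Equiv.Perm.mem_sumCongrHom_range_of_perm_mapsTo_inl hmaps
  rw [Equiv.Perm.sumCongrHom_apply] at hτ
  refine ⟨τ, ?_⟩
  have hσ : σ = finSumFinEquiv.permCongr σ' := by
    ext1 i
    simp [σ', Equiv.permCongr_apply]
  have hρ : ρ = 1 := by
    ext1 a
    have := hr a
    rw [← hτ] at this
    simpa using this
  rw [hσ, ← hτ, hρ]
  rfl

theorem pairFst_castLE (k : Fin (m / 2)) :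
    (pairFst (Fin.castLE (by omega) k : Fin ((m + 2) / 2)) : Fin (m + 2)) =
      Fin.castAdd 2 (pairFst k) := rfl

theorem pairSnd_castLE (k : Fin (m / 2)) :
    (pairSnd (Fin.castLE (by omega) k : Fin ((m + 2) / 2)) : Fin (m + 2)) =
      Fin.castAdd 2 (pairSnd k) := rfl

theorem pairFst_last (hm : Even m) :
    (pairFst (⟨m / 2, by omega⟩ : Fin ((m + 2) / 2)) : Fin (m + 2)) = Fin.natAdd m 0 := by
  ext
  simpa [pairFst] using Nat.two_mul_div_two_of_even hm

theorem pairSnd_last (hm : Even m) :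
    (pairSnd (⟨m / 2, by omega⟩ : Fin ((m + 2) / 2)) : Fin (m + 2)) = Fin.natAdd m 1 := by
  ext
  simpa [pairSnd] using Nat.two_mul_div_two_of_even hm

theorem half_cases (k : Fin ((m + 2) / 2)) :
    (∃ l : Fin (m / 2), k = Fin.castLE (by omega) l) ∨ k = ⟨m / 2, by omega⟩ := by
  have := k.2
  by_cases h : k.1 < m / 2
  · exact Or.inl ⟨⟨k.1, h⟩, rfl⟩
  · exact Or.inr (Fin.ext (by simp only; omega))

theorem isPairing_extendPerm (hm : Even m) (τ : Equiv.Perm (Fin m)) :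
    IsPairing (extendPerm τ) ↔ IsPairing τ := by
  constructor
  · rintro ⟨h1, h2⟩
    refine ⟨fun k => ?_, fun k l hkl => ?_⟩
    · have := h1 (Fin.castLE (by omega) k)
      rwa [pairFst_castLE, pairSnd_castLE, extendPerm_castAdd, extendPerm_castAdd] at this
    · have := h2 (Fin.castLE (by omega) k) (Fin.castLE (by omega) l) hkl
      rwa [pairFst_castLE, pairFst_castLE, extendPerm_castAdd, extendPerm_castAdd] at this
  · rintro ⟨h1, h2⟩
    refine ⟨fun k => ?_, fun k l hkl => ?_⟩
    · rcases half_cases k with ⟨k, rfl⟩ | rfl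
      · rw [pairFst_castLE, pairSnd_castLE, extendPerm_castAdd, extendPerm_castAdd]
        exact h1 k
      · rw [pairFst_last hm, pairSnd_last hm, extendPerm_natAdd, extendPerm_natAdd]
        simp [Fin.lt_def]
    · rcases half_cases k with ⟨k, rfl⟩ | rfl <;> rcases half_cases l with ⟨l, rfl⟩ | rfl
      · rw [pairFst_castLE, pairFst_castLE, extendPerm_castAdd, extendPerm_castAdd]
        exact h2 k l hkl
      · rw [pairFst_castLE, pairFst_last hm, extendPerm_castAdd, extendPerm_natAdd]
        simp [Fin.lt_def]
      · have := l.2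
        simp only [Fin.lt_def, Fin.val_castLE] at hkl
        omega
      · exact absurd hkl (lt_irrefl _)

theorem pfTerm_extendPerm (hm : Even m) (D : Matrix (Fin (m + 2)) (Fin (m + 2)) R)
    (τ : Equiv.Perm (Fin m)) :
    pfTerm D (extendPerm τ) = D (Fin.natAdd m 0) (Fin.natAdd m 1) *
      pfTerm (D.submatrix (Fin.castAdd 2) (Fin.castAdd 2)) τ := by
  have hlen : m / 2 + 1 = (m + 2) / 2 := by omega
  have hc : ∀ k : Fin (m / 2), finCongr hlen k.castSucc = Fin.castLE (by omega) k := fun _ => rfl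
  have hl : finCongr hlen (Fin.last (m / 2)) = ⟨m / 2, by omega⟩ := rfl
  rw [pfTerm, pfTerm, sign_extendPerm, ← (finCongr hlen).prod_comp, Fin.prod_univ_castSucc]
  simp only [hc, hl, pairFst_castLE, pairSnd_castLE, pairFst_last hm, pairSnd_last hm,
    extendPerm_castAdd, extendPerm_natAdd, Matrix.submatrix_apply, zsmul_eq_mul]
  ring

/-- Expansion of the Pfaffian along a column that vanishes above the last pair. -/
theorem pf_eq_mul_pf_castAdd (hm : Even m) (D : Matrix (Fin (m + 2)) (Fin (m + 2)) R)
    (h0 : ∀ i : Fin m, D (Fin.castAdd 2 i) (Fin.natAdd m 0) = 0) :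
    pf D = D (Fin.natAdd m 0) (Fin.natAdd m 1) *
      pf (D.submatrix (Fin.castAdd 2) (Fin.castAdd 2)) := by
  rw [pf_eq_sum_pfTerm, pf_eq_sum_pfTerm, Finset.mul_sum]
  symm
  refine Finset.sum_of_injOn extendPerm ?_ ?_ ?_ fun τ _ => (pfTerm_extendPerm hm D τ).symm
  · intro τ _ ρ _ h
    ext1 i
    have := congrArg (fun f : Equiv.Perm (Fin (m + 2)) => f (Fin.castAdd 2 i)) h
    simpa only [extendPerm_castAdd, Fin.castAdd_inj] using this
  · intro τ hτ
    simpa [isPairing_extendPerm hm] using hτ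
  · intro σ hσ hout
    by_contra hne
    have hpair : IsPairing σ := by simpa using hσ
    have hprod : ∀ k, D (σ (pairFst k)) (σ (pairSnd k)) ≠ 0 := by
      intro k hk
      exact hne (by rw [pfTerm, Finset.prod_eq_zero (Finset.mem_univ k) hk, smul_zero])
    have above : ∀ j : Fin (m + 2), Fin.natAdd m 0 < j → j = Fin.natAdd m 1 := by
      intro j hj
      have := j.2
      ext
      simp [Fin.lt_def] at hj ⊢
      omega
    have hm2 : Even (m + 2) := by simpa [Nat.even_add] using hm
    obtain ⟨⟨k, a⟩, hk⟩ := (pairEquiv hm2).surjective (σ.symm (Fin.natAdd m 0))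
    rw [Equiv.eq_symm_apply] at hk
    have hfst : σ (pairFst k) = Fin.natAdd m 0 := by
      fin_cases a
      · simpa using hk
      · replace hk : σ (pairSnd k) = Fin.natAdd m 0 := by simpa using hk
        have hlt := hpair.1 k
        rw [hk] at hlt
        refine absurd ?_ (hprod k)
        rw [hk]
        exact h0 ⟨σ (pairFst k), by simpa [Fin.lt_def] using hlt⟩
    have hsnd : σ (pairSnd k) = Fin.natAdd m 1 := above _ (hfst ▸ hpair.1 k)
    have hlast : k = ⟨m / 2, by omega⟩ := by
      rcases half_cases k with ⟨l, rfl⟩ | h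
      · have hlt := hpair.2 (Fin.castLE (by omega) l) ⟨m / 2, by omega⟩ (by
          simp [Fin.lt_def])
        rw [hfst] at hlt
        have := congrArg Fin.val (σ.injective ((above _ hlt).trans hsnd.symm))
        simp only [pairFst, pairSnd, Fin.val_castLE] at this
        omega
      · exact h
    rw [hlast, pairFst_last hm] at hfst
    rw [hlast, pairSnd_last hm] at hsnd
    obtain ⟨τ, rfl⟩ := exists_extendPerm_eq (σ := σ) (by
      intro a; fin_cases a
      · exact hfst
      · exact hsnd)
    exact hout ⟨τ, by simpa [isPairing_extendPerm hm] using hpair, rfl⟩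

theorem pf_eq_prod_mul_pf_castLE {p : ℕ} (hp : Even p) (q : ℕ) {T : ℕ} (hT : T = p + 2 * q)
    (D : Matrix (Fin T) (Fin T) R)
    (h0 : ∀ t : Fin q, ∀ i : Fin T, i.1 < p + 2 * t.1 → D i ⟨p + 2 * t.1, by omega⟩ = 0) :
    pf D = (∏ t : Fin q, D ⟨p + 2 * t.1, by omega⟩ ⟨p + 2 * t.1 + 1, by omega⟩) *
      pf (D.submatrix (Fin.castLE (show p ≤ T by omega)) (Fin.castLE (by omega))) := by
  induction q generalizing T with
  | zero =>
    obtain rfl : T = p := by omega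
    simp only [Finset.univ_eq_empty, Finset.prod_empty, one_mul]
    rfl
  | succ q ih =>
    subst hT
    change Matrix (Fin (p + 2 * q + 2)) (Fin (p + 2 * q + 2)) R at D
    have hev : Even (p + 2 * q) := by simpa [Nat.even_add] using hp
    rw [show pf D = _ from pf_eq_mul_pf_castAdd hev D fun i =>
      h0 (Fin.last q) (Fin.castAdd 2 i) i.2,
      ih rfl (D.submatrix (Fin.castAdd 2) (Fin.castAdd 2)) fun t i hi =>
        h0 t.castSucc (Fin.castAdd 2 i) hi, Fin.prod_univ_castSucc, ← mul_assoc]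
    congr 1
    rw [mul_comm]
    rfl

end PfaffianExpansion

section Reordering

variable {ι M P : Type*} {T : ℕ}

theorem sign_symm_trans_eq_prod [Fintype ι] (e₁ e₂ : ι ≃ Fin T) :
    Equiv.Perm.sign (e₁.symm.trans e₂) =
      ∏ y : ι, ∏ x : ι, if e₁ x < e₁ y ∧ e₂ y < e₂ x then -1 else 1 := by
  rw [Equiv.Perm.sign_eq_prod_prod_Iio, ← e₁.prod_comp]
  refine Finset.prod_congr rfl fun y _ => ?_
  rw [← Finset.prod_subset (Finset.subset_univ (Finset.univ.filter fun x => e₁ x < e₁ y))]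
  · refine Finset.prod_bij' (fun i _ => e₁.symm i) (fun x _ => e₁ x) ?_ ?_ ?_ ?_ ?_
    · simp
    · simp
    · simp
    · simp
    · intro i hi
      have hi' : i < e₁ y := by simpa using hi
      have hne : e₂ (e₁.symm i) ≠ e₂ y := fun h => by
        rw [← e₂.injective h] at hi'; simp at hi'
      rcases lt_or_gt_of_ne hne with h | h
      · simp [h, hi', h.not_gt]
      · simp [h, hi', h.not_gt]
  · intro x _ hx
    rw [if_neg]
    simpa using fun h1 => absurd h1 (by simpa using hx)

/-- The enumeration listing first the elements of `M` and then the pairs indexed by `P`. -/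
def pairsLastEquiv {p q : ℕ} (hT : p + q * 2 = T) (eM : M ≃ Fin p) (eP : P ≃ Fin q) :
    M ⊕ P × Fin 2 ≃ Fin T :=
  ((Equiv.sumCongr eM ((Equiv.prodCongr eP (Equiv.refl _)).trans finProdFinEquiv)).trans
    finSumFinEquiv).trans (finCongr hT)

theorem pairsLastEquiv_inl_val {p q : ℕ} (hT : p + q * 2 = T) (eM : M ≃ Fin p) (eP : P ≃ Fin q)
    (x : M) : (pairsLastEquiv hT eM eP (Sum.inl x)).1 = (eM x).1 := by
  simp [pairsLastEquiv]

theorem pairsLastEquiv_inr_val {p q : ℕ} (hT : p + q * 2 = T) (eM : M ≃ Fin p) (eP : P ≃ Fin q)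
    (t : P) (a : Fin 2) :
    (pairsLastEquiv hT eM eP (Sum.inr (t, a))).1 = p + 2 * (eP t).1 + a.1 := by
  simp [pairsLastEquiv]; omega

theorem sign_symm_trans_pairsLastEquiv [Fintype M] [Fintype P] {p q : ℕ} (hT : p + q * 2 = T)
    (eM : M ≃ Fin p) (eP : P ≃ Fin q) (e : M ⊕ P × Fin 2 ≃ Fin T)
    (hM : ∀ x y, e (Sum.inl x) < e (Sum.inl y) → eM x < eM y)
    (hP : ∀ t t' a a', e (Sum.inr (t, a)) < e (Sum.inr (t', a')) → eP t < eP t' ∨ t = t' ∧ a < a')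
    (hMP : ∀ t y, e (Sum.inr (t, 0)) < e (Sum.inl y) ↔ e (Sum.inr (t, 1)) < e (Sum.inl y)) :
    Equiv.Perm.sign (e.symm.trans (pairsLastEquiv hT eM eP)) = 1 := by
  rw [sign_symm_trans_eq_prod]
  refine Finset.prod_eq_one fun y _ => ?_
  rw [Fintype.prod_sum_type, Fintype.prod_prod_type]
  rcases y with y | ⟨t', a'⟩
  · rw [Finset.prod_eq_one, Finset.prod_eq_one, one_mul]
    · intro t _
      rw [Fin.prod_univ_two]
      have h : ∀ a, pairsLastEquiv hT eM eP (Sum.inl y) <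
          pairsLastEquiv hT eM eP (Sum.inr (t, a)) :=
        fun a => by
          rw [Fin.lt_def, pairsLastEquiv_inl_val, pairsLastEquiv_inr_val]
          have := (eM y).2
          omega
      simp only [h, and_true, hMP]
      split_ifs <;> rfl
    · intro x _
      rw [if_neg]
      rintro ⟨h1, h2⟩
      rw [Fin.lt_def, pairsLastEquiv_inl_val, pairsLastEquiv_inl_val] at h2
      exact lt_asymm (hM _ _ h1) h2
  · rw [Finset.prod_eq_one, Finset.prod_eq_one, one_mul]
    · intro t _
      refine Finset.prod_eq_one fun a _ => ?_
      rw [if_neg]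
      rintro ⟨h1, h2⟩
      rw [Fin.lt_def, pairsLastEquiv_inr_val, pairsLastEquiv_inr_val] at h2
      rcases hP _ _ _ _ h1 with h | ⟨rfl, h⟩
      · have := a'.2
        rw [Fin.lt_def] at h
        omega
      · rw [Fin.lt_def] at h
        omega
    · intro x _
      rw [if_neg]
      rintro ⟨-, h2⟩
      rw [Fin.lt_def, pairsLastEquiv_inl_val, pairsLastEquiv_inr_val] at h2
      have := (eM x).2
      omega

variable {R : Type*} [CommRing R]

/-- Elimination of pairs of indices `(t, 0), (t, 1)` that are adjacent in the enumeration,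
for a matrix whose columns `(t, 0)` vanish at all remaining and all earlier indices. -/
theorem pf_reindex_eq_prod_mul_pf [IsDomain R] [CharZero R] [Fintype M] [Fintype P] {p q : ℕ}
    (hp : Even p) (hT : p + q * 2 = T)
    (eM : M ≃ Fin p) (eP : P ≃ Fin q) (e : M ⊕ P × Fin 2 ≃ Fin T)
    (hM : ∀ x y, e (Sum.inl x) < e (Sum.inl y) → eM x < eM y)
    (hP : ∀ t t' a a', e (Sum.inr (t, a)) < e (Sum.inr (t', a')) → eP t < eP t' ∨ t = t' ∧ a < a')
    (hMP : ∀ t y, e (Sum.inr (t, 0)) < e (Sum.inl y) ↔ e (Sum.inr (t, 1)) < e (Sum.inl y))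
    (D : Matrix (M ⊕ P × Fin 2) (M ⊕ P × Fin 2) R) (hD : ∀ i j, D i j = -D j i)
    (hDM : ∀ x t, D (Sum.inl x) (Sum.inr (t, 0)) = 0)
    (hDP : ∀ t t' a, eP t' < eP t → D (Sum.inr (t', a)) (Sum.inr (t, 0)) = 0) :
    pf (Matrix.reindex e e D) = (∏ t, D (Sum.inr (t, 0)) (Sum.inr (t, 1))) *
      pf (Matrix.reindex eM eM (D.submatrix Sum.inl Sum.inl)) := by
  set e₂ := pairsLastEquiv hT eM eP with he₂
  have hTe : Even T := by rw [← hT]; simpa [Nat.even_add] using hp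
  have h1 : Matrix.reindex e e D =
      (Matrix.reindex e₂ e₂ D).submatrix (e.symm.trans e₂) (e.symm.trans e₂) := by
    ext i j; simp
  rw [h1, pf_submatrix_perm hTe (Matrix.reindex e₂ e₂ D) (fun i j => hD _ _) (e.symm.trans e₂), he₂,
    sign_symm_trans_pairsLastEquiv hT eM eP e hM hP hMP, ← he₂]
  have hinr : ∀ (t : Fin q) (a : Fin 2) (h : p + 2 * t.1 + a.1 < T),
      e₂.symm ⟨p + 2 * t.1 + a.1, h⟩ = Sum.inr (eP.symm t, a) := by
    intro t a h
    rw [Equiv.symm_apply_eq]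
    ext
    rw [he₂, pairsLastEquiv_inr_val, Equiv.apply_symm_apply]
  have hinl : ∀ (i : Fin p) (h : p ≤ T),
      e₂.symm (Fin.castLE h i) = Sum.inl (eM.symm i) := by
    intro i h
    rw [Equiv.symm_apply_eq]
    ext
    rw [he₂, pairsLastEquiv_inl_val, Equiv.apply_symm_apply, Fin.val_castLE]
  rw [pf_eq_prod_mul_pf_castLE hp q (by omega) (Matrix.reindex e₂ e₂ D)]
  · simp only [Units.val_one, Int.cast_one, one_mul]
    congr 1
    · rw [← eP.symm.prod_comp]
      refine Finset.prod_congr rfl fun t _ => ?_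
      rw [← hinr t 0 (by have := t.2; simp; omega), ← hinr t 1 (by have := t.2; simp; omega)]
      rfl
    · congr 1
      ext i j
      simp [hinl]
  · intro t i hi
    have hcol := hinr t 0 (by have := t.2; simp; omega)
    rw [Matrix.reindex_apply, Matrix.submatrix_apply]
    erw [hcol]
    obtain ⟨x, rfl⟩ := e₂.surjective i
    rw [Equiv.symm_apply_apply]
    rcases x with x | ⟨t', a⟩
    · exact hDM _ _
    · refine hDP _ _ _ ?_
      rw [he₂, pairsLastEquiv_inr_val] at hi
      rw [Equiv.apply_symm_apply, Fin.lt_def]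
      omega

end Reordering

section BlockEnumeration

theorem mySigmaEquiv_lt_iff {b : ℕ} (f : Fin b → ℕ) (x y : Σ k : Fin b, Fin (f k)) :
    mySigmaEquiv f x < mySigmaEquiv f y ↔ x.1 < y.1 ∨ x.1 = y.1 ∧ x.2.1 < y.2.1 := by
  induction b with
  | zero => exact x.1.elim0
  | succ b ih =>
    obtain ⟨x, rfl⟩ := (sigmaSuccEquiv f).symm.surjective x
    obtain ⟨y, rfl⟩ := (sigmaSuccEquiv f).symm.surjective y
    rcases x with i | ⟨k, i⟩ <;> rcases y with j | ⟨l, j⟩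
    · simp [mySigmaEquiv, Fin.lt_def, sigmaSuccEquiv, -Fin.val_fin_lt]
    · have := i.2
      simp [mySigmaEquiv, Fin.lt_def, sigmaSuccEquiv]
      omega
    · have := j.2
      simp [mySigmaEquiv, Fin.lt_def, sigmaSuccEquiv]
      omega
    · have := ih (fun k => f k.succ) ⟨k, i⟩ ⟨l, j⟩
      simp only [mySigmaEquiv, Equiv.trans_apply, Equiv.apply_symm_apply, Equiv.sumCongr_apply,
        Sum.map_inr, finSumFinEquiv_apply_right, finCongr_apply, Fin.lt_def, Fin.val_cast,
        Fin.val_natAdd, Nat.add_lt_add_iff_left] at this ⊢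
      rw [this]
      simp [sigmaSuccEquiv]

/-- The enumeration of consecutive blocks of sizes `f k`, followed by a block of size `m`. -/
abbrev blocksEquiv {b : ℕ} (f : Fin b → ℕ) (m : ℕ) :
    (Σ k : Fin b, Fin (f k)) ⊕ Fin m ≃ Fin (∑ k, f k + m) :=
  (Equiv.sumCongr (mySigmaEquiv f) (Equiv.refl (Fin m))).trans finSumFinEquiv

variable {b m : ℕ} (f : Fin b → ℕ)

theorem blocksEquiv_inl_lt_inl (x y : Σ k : Fin b, Fin (f k)) :
    blocksEquiv f m (Sum.inl x) < blocksEquiv f m (Sum.inl y) ↔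
      x.1 < y.1 ∨ x.1 = y.1 ∧ x.2.1 < y.2.1 := by
  rw [← mySigmaEquiv_lt_iff]
  simp [Fin.lt_def, -Fin.val_fin_lt]

theorem blocksEquiv_inl_lt_inr (x : Σ k : Fin b, Fin (f k)) (t : Fin m) :
    blocksEquiv f m (Sum.inl x) < blocksEquiv f m (Sum.inr t) := by
  have := (mySigmaEquiv f x).2
  simp [Fin.lt_def, -Fin.val_fin_lt]
  omega

theorem blocksEquiv_inr_lt_inr (s t : Fin m) :
    blocksEquiv f m (Sum.inr s) < blocksEquiv f m (Sum.inr t) ↔ s < t := by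
  simp [Fin.lt_def, -Fin.val_fin_lt]

end BlockEnumeration

section CircuitSplitting

/-- Splitting the indices of a circuit block `I ∪ J` into the circuit vertices, together with
the last index of `J` in the role of the virtual vertex, and the `n` consecutive pairs in `J`. -/
def circuitSplitEquiv (n c : ℕ) :
    Fin (2 * n + c) ⊕ Fin n × Fin 2 ≃ Fin (2 * n) ⊕ Fin (2 * n + c) where
  toFun x := match x with
    | Sum.inl i => if h : i.1 < 2 * n then Sum.inl ⟨i.1, h⟩ else Sum.inr i
    | Sum.inr (l, a) => Sum.inr ⟨2 * l.1 + a.1, by omega⟩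
  invFun x := match x with
    | Sum.inl i => Sum.inl (Fin.castAdd c i)
    | Sum.inr j =>
      if h : j.1 < 2 * n then Sum.inr (⟨j.1 / 2, by omega⟩, ⟨j.1 % 2, by omega⟩) else Sum.inl j
  left_inv := by
    rintro (i | ⟨l, a⟩)
    · by_cases h : i.1 < 2 * n <;> simp [h]
    · have h : 2 * l.1 + a.1 < 2 * n := by omega
      simp only [h, dif_pos, Sum.inr.injEq, Prod.mk.injEq, Fin.ext_iff]
      omega
  right_inv := by
    rintro (i | j)
    · simp
    · by_cases h : j.1 < 2 * n
      · simp only [h, dif_pos, Sum.inr.injEq, Fin.ext_iff]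
        omega
      · simp [h]

variable {n c : ℕ}

theorem circuitSplitEquiv_inl_of_lt (i : Fin (2 * n + c)) (h : i.1 < 2 * n) :
    circuitSplitEquiv n c (Sum.inl i) = Sum.inl ⟨i.1, h⟩ := by
  simp [circuitSplitEquiv, h]

theorem circuitSplitEquiv_inl_of_not_lt (i : Fin (2 * n + c)) (h : ¬ i.1 < 2 * n) :
    circuitSplitEquiv n c (Sum.inl i) = Sum.inr i := by
  simp [circuitSplitEquiv, h]

theorem circuitSplitEquiv_inr (l : Fin n) (a : Fin 2) :
    circuitSplitEquiv n c (Sum.inr (l, a)) = Sum.inr ⟨2 * l.1 + a.1, by omega⟩ := rfl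

theorem finSumFinEquiv_circuitSplitEquiv_inl_val (i : Fin (2 * n + c)) :
    (finSumFinEquiv (circuitSplitEquiv n c (Sum.inl i))).1 =
      if i.1 < 2 * n then i.1 else 2 * n + i.1 := by
  by_cases h : i.1 < 2 * n
  · simp [circuitSplitEquiv_inl_of_lt i h, h]
  · simp [circuitSplitEquiv_inl_of_not_lt i h, h]

theorem finSumFinEquiv_circuitSplitEquiv_inr_val (l : Fin n) (a : Fin 2) :
    (finSumFinEquiv (circuitSplitEquiv n c (Sum.inr (l, a)))).1 = 2 * n + (2 * l.1 + a.1) := by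
  simp [circuitSplitEquiv_inr]

variable {b : ℕ} (n c : Fin b → ℕ) (m : ℕ)

/-- The splitting `circuitSplitEquiv` performed in all circuits simultaneously. -/
def splitEquiv :
    ((Σ k : Fin b, Fin (2 * n k + c k)) ⊕ Fin m) ⊕ (Σ k : Fin b, Fin (n k)) × Fin 2 ≃
      (Σ k : Fin b, Fin (2 * n k) ⊕ Fin (2 * n k + c k)) ⊕ Fin m where
  toFun x := match x with
    | Sum.inl (Sum.inl ⟨k, i⟩) => Sum.inl ⟨k, circuitSplitEquiv (n k) (c k) (Sum.inl i)⟩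
    | Sum.inl (Sum.inr t) => Sum.inr t
    | Sum.inr (⟨k, l⟩, a) => Sum.inl ⟨k, circuitSplitEquiv (n k) (c k) (Sum.inr (l, a))⟩
  invFun x := match x with
    | Sum.inl ⟨k, z⟩ => match (circuitSplitEquiv (n k) (c k)).symm z with
      | Sum.inl i => Sum.inl (Sum.inl ⟨k, i⟩)
      | Sum.inr (l, a) => Sum.inr (⟨k, l⟩, a)
    | Sum.inr t => Sum.inl (Sum.inr t)
  left_inv := by
    rintro ((⟨k, i⟩ | t) | ⟨⟨k, l⟩, a⟩)
    · simp only [Equiv.symm_apply_apply]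
    · rfl
    · simp only [Equiv.symm_apply_apply]
  right_inv := by
    rintro (⟨k, z⟩ | t)
    · obtain ⟨z, rfl⟩ := (circuitSplitEquiv (n k) (c k)).surjective z
      rcases z with i | ⟨l, a⟩ <;> simp only [Equiv.symm_apply_apply]
    · rfl

/-- The enumeration of the indices of the big matrix. -/
abbrev bigEquiv :
    (Σ k : Fin b, Fin (2 * n k) ⊕ Fin (2 * n k + c k)) ⊕ Fin m ≃
      Fin (∑ k, (2 * n k + (2 * n k + c k)) + m) :=
  (Equiv.sumCongr
    ((Equiv.sigmaCongrRight fun k : Fin b =>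
        (finSumFinEquiv : Fin (2 * n k) ⊕ Fin (2 * n k + c k) ≃ _)).trans
      (mySigmaEquiv fun k => 2 * n k + (2 * n k + c k)))
    (Equiv.refl (Fin m))).trans finSumFinEquiv

theorem splitEquiv_inl_inl (k : Fin b) (i : Fin (2 * n k + c k)) :
    splitEquiv n c m (Sum.inl (Sum.inl ⟨k, i⟩)) =
      Sum.inl ⟨k, circuitSplitEquiv (n k) (c k) (Sum.inl i)⟩ := rfl

theorem splitEquiv_inl_inr (t : Fin m) :
    splitEquiv n c m (Sum.inl (Sum.inr t)) = Sum.inr t := rfl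

theorem splitEquiv_inr (k : Fin b) (l : Fin (n k)) (a : Fin 2) :
    splitEquiv n c m (Sum.inr (⟨k, l⟩, a)) =
      Sum.inl ⟨k, circuitSplitEquiv (n k) (c k) (Sum.inr (l, a))⟩ := rfl

theorem splitEquiv_trans_bigEquiv_inl (k : Fin b) (i : Fin (2 * n k + c k)) :
    (splitEquiv n c m).trans (bigEquiv n c m) (Sum.inl (Sum.inl ⟨k, i⟩)) =
      blocksEquiv (fun k => 2 * n k + (2 * n k + c k)) m
        (Sum.inl ⟨k, finSumFinEquiv (circuitSplitEquiv (n k) (c k) (Sum.inl i))⟩) := rfl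

theorem splitEquiv_trans_bigEquiv_inr (k : Fin b) (l : Fin (n k)) (a : Fin 2) :
    (splitEquiv n c m).trans (bigEquiv n c m) (Sum.inr (⟨k, l⟩, a)) =
      blocksEquiv (fun k => 2 * n k + (2 * n k + c k)) m
        (Sum.inl ⟨k, finSumFinEquiv (circuitSplitEquiv (n k) (c k) (Sum.inr (l, a)))⟩) := rfl

variable {R : Type*} [CommRing R] [IsDomain R] [CharZero R]

theorem pf_reindex_bigEquiv (hp : Even (∑ k, (2 * n k + c k) + m))
    (D : Matrix ((Σ k : Fin b, Fin (2 * n k) ⊕ Fin (2 * n k + c k)) ⊕ Fin m)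
      ((Σ k : Fin b, Fin (2 * n k) ⊕ Fin (2 * n k + c k)) ⊕ Fin m) R)
    (hD : ∀ i j, D i j = -D j i)
    (hDM : ∀ x k l, D (splitEquiv n c m (Sum.inl x)) (splitEquiv n c m (Sum.inr (⟨k, l⟩, 0))) = 0)
    (hDP : ∀ k l l' a, l' < l → D (splitEquiv n c m (Sum.inr (⟨k, l'⟩, a)))
      (splitEquiv n c m (Sum.inr (⟨k, l⟩, 0))) = 0)
    (hDP' : ∀ k k' l l' a, k' ≠ k → D (splitEquiv n c m (Sum.inr (⟨k', l'⟩, a)))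
      (splitEquiv n c m (Sum.inr (⟨k, l⟩, 0))) = 0) :
    pf (Matrix.reindex (bigEquiv n c m) (bigEquiv n c m) D) =
      (∏ k, ∏ l, D (splitEquiv n c m (Sum.inr (⟨k, l⟩, 0)))
        (splitEquiv n c m (Sum.inr (⟨k, l⟩, 1)))) *
      pf (Matrix.reindex (blocksEquiv (fun k => 2 * n k + c k) m)
        (blocksEquiv (fun k => 2 * n k + c k) m)
        (D.submatrix (fun x => splitEquiv n c m (Sum.inl x))
          (fun x => splitEquiv n c m (Sum.inl x)))) := by
  have hT : (∑ k, (2 * n k + c k) + m) + (∑ k, n k) * 2 =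
      ∑ k, (2 * n k + (2 * n k + c k)) + m := by
    have : ∑ k, (2 * n k + (2 * n k + c k)) = ∑ k, (2 * n k + c k) + (∑ k, n k) * 2 := by
      rw [Finset.sum_mul, ← Finset.sum_add_distrib]
      exact Finset.sum_congr rfl fun k _ => by ring
    omega
  have key := pf_reindex_eq_prod_mul_pf hp hT (blocksEquiv (fun k => 2 * n k + c k) m)
    (mySigmaEquiv n) ((splitEquiv n c m).trans (bigEquiv n c m)) ?_ ?_ ?_
    (D.submatrix (splitEquiv n c m) (splitEquiv n c m)) (fun i j => hD _ _)
    (fun x t => hDM x t.1 t.2) ?_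
  · have h : Matrix.reindex ((splitEquiv n c m).trans (bigEquiv n c m))
        ((splitEquiv n c m).trans (bigEquiv n c m))
        (D.submatrix (splitEquiv n c m) (splitEquiv n c m)) =
        Matrix.reindex (bigEquiv n c m) (bigEquiv n c m) D := by
      ext i j; simp
    rw [h, Fintype.prod_sigma] at key
    exact key
  · rintro (⟨k, i⟩ | s) (⟨l, j⟩ | t) h
    · rw [blocksEquiv_inl_lt_inl]
      rw [splitEquiv_trans_bigEquiv_inl, splitEquiv_trans_bigEquiv_inl, blocksEquiv_inl_lt_inl,
        finSumFinEquiv_circuitSplitEquiv_inl_val, finSumFinEquiv_circuitSplitEquiv_inl_val] at h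
      rcases h with h | ⟨rfl, h⟩
      · exact Or.inl h
      · refine Or.inr ⟨rfl, ?_⟩
        dsimp only at h ⊢
        split_ifs at h <;> omega
    · exact blocksEquiv_inl_lt_inr _ _ _
    · exact absurd h (blocksEquiv_inl_lt_inr _ _ _).not_gt
    · rw [blocksEquiv_inr_lt_inr]
      exact (blocksEquiv_inr_lt_inr _ _ _).mp h
  · rintro ⟨k, l⟩ ⟨k', l'⟩ a a' h
    rw [splitEquiv_trans_bigEquiv_inr, splitEquiv_trans_bigEquiv_inr, blocksEquiv_inl_lt_inl,
      finSumFinEquiv_circuitSplitEquiv_inr_val, finSumFinEquiv_circuitSplitEquiv_inr_val] at h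
    rw [mySigmaEquiv_lt_iff]
    rcases h with h | ⟨rfl, h⟩
    · exact Or.inl (Or.inl h)
    · dsimp only at h ⊢
      rcases lt_trichotomy l.1 l'.1 with h' | h' | h'
      · exact Or.inl (Or.inr ⟨rfl, h'⟩)
      · obtain rfl := Fin.ext h'
        exact Or.inr ⟨rfl, by rw [Fin.lt_def]; omega⟩
      · omega
  · rintro ⟨k, l⟩ (⟨k', i⟩ | t)
    · rw [splitEquiv_trans_bigEquiv_inr, splitEquiv_trans_bigEquiv_inr,
        splitEquiv_trans_bigEquiv_inl, blocksEquiv_inl_lt_inl, blocksEquiv_inl_lt_inl,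
        finSumFinEquiv_circuitSplitEquiv_inr_val, finSumFinEquiv_circuitSplitEquiv_inr_val,
        finSumFinEquiv_circuitSplitEquiv_inl_val]
      refine or_congr Iff.rfl (and_congr_right fun h => ?_)
      dsimp only at h ⊢
      subst h
      have := l.2
      simp only [Fin.val_zero, Fin.val_one]
      split_ifs <;> omega
    · exact iff_of_true (blocksEquiv_inl_lt_inr _ _ _) (blocksEquiv_inl_lt_inr _ _ _)
  · rintro ⟨k, l⟩ ⟨k', l'⟩ a h
    rw [mySigmaEquiv_lt_iff] at h
    rcases h with h | ⟨h, h'⟩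
    · exact hDP' k k' l l' a h.ne
    · obtain rfl : k' = k := h
      exact hDP k' l l' a h'

end CircuitSplitting

section CircuitEntries

variable {K : Type*}

@[to_additive]
theorem prod_range_double [CommMonoid K] (f : ℕ → K) (n : ℕ) :
    ∏ j ∈ Finset.range (2 * n), f j = ∏ r ∈ Finset.range n, f (2 * r) * f (2 * r + 1) := by
  induction n with
  | zero => simp
  | succ n ih => rw [mul_add, Finset.prod_range_succ, Finset.prod_range_succ, ih,
      Finset.prod_range_succ, mul_assoc]

variable [Field K] {n : ℕ} {c : Bool}

theorem sum_fin_two_mul_add_cond (n : ℕ) (c : Bool) (f : ℕ → K) :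
    ∑ j : Fin (2 * n + cond c 1 0), f j.1 =
      ∑ r ∈ Finset.range n, (f (2 * r) + f (2 * r + 1)) + cond c (f (2 * n)) 0 := by
  rw [Fin.sum_univ_eq_sum_range, ← sum_range_double]
  cases c
  · simp
  · simp [Finset.sum_range_succ]

theorem BblkE_even_even (hn : 2 ≤ n) {r s : ℕ} (hr : r < n) (hs : s < n) :
    BblkE (2 * n) c (2 * r) (2 * s) = (0 : K) := by
  unfold BblkE
  split_ifs <;> first | rfl | omega

theorem BblkE_odd_odd (r s : ℕ) :
    BblkE (2 * n) c (2 * r + 1) (2 * s + 1) = (0 : K) := by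
  unfold BblkE
  split_ifs <;> first | rfl | omega | simp_all

theorem BblkE_odd_even (hn : 2 ≤ n) {r s : ℕ} (hr : r < n) (hs : s < n) :
    BblkE (2 * n) c (2 * s + 1) (2 * r) =
      (if r = s then (1 : K) else 0) - (if r = s + 1 then (1 : K) else 0) -
        cond c (1 : K) (-1) * (if r = 0 ∧ s = n - 1 then (1 : K) else 0) := by
  unfold BblkE
  cases c <;> split_ifs <;> first | omega | simp

theorem BblkE_odd_last {r : ℕ} (hr : r < n) :
    BblkE (2 * n) c (2 * r + 1) (2 * n) = (1 : K) := by
  unfold BblkE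
  split_ifs <;> first | omega | simp [pow_succ, pow_mul]

theorem BblkE_last_even {r : ℕ} (hr : r < n) :
    BblkE (2 * n) c (2 * n) (2 * r) = (1 : K) := by
  unfold BblkE
  split_ifs <;> first | omega | simp [pow_succ, pow_mul]

theorem BblkE_last_odd {r : ℕ} (hr : r < n) :
    BblkE (2 * n) c (2 * n) (2 * r + 1) = (-1 : K) := by
  unfold BblkE
  split_ifs <;> first | omega | simp [pow_succ, pow_mul]

theorem BblkE_last_last (hn : 2 ≤ n) : BblkE (2 * n) c (2 * n) (2 * n) = (0 : K) := by
  unfold BblkE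
  split_ifs <;> first | rfl | omega

theorem BblkE_antisymm {R : Type*} [CommRing R] (hn : 2 ≤ n) (i j : ℕ) :
    BblkE (2 * n) c i j = -(BblkE (2 * n) c j i : R) := by
  unfold BblkE
  cases c <;> split_ifs <;> first | omega | simp

theorem AblkE_even (y : Fin (2 * n) → K) (i : Fin (2 * n)) (q : ℕ) :
    AblkE (2 * n) c y i.1 (2 * q) =
      (-1) ^ i.1 * y i * (-(if q = i.1 / 2 then (1 : K) else 0)) := by
  unfold AblkE
  obtain ⟨i, hi⟩ := i
  split_ifs <;> first | omega | simp_all [pow_succ]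

theorem AblkE_odd (y : Fin (2 * n) → K) (i : Fin (2 * n)) {q : ℕ} (hq : q < n) :
    AblkE (2 * n) c y i.1 (2 * q + 1) =
      (-1) ^ i.1 * y i * (if i.1 = 0 then (if q = n - 1 then -cond c (1 : K) (-1) else 0)
        else -(if q = (i.1 - 1) / 2 then (1 : K) else 0)) := by
  unfold AblkE
  obtain ⟨i, hi⟩ := i
  cases c <;> split_ifs <;> first | omega | simp_all [pow_succ]

theorem AblkE_last (hn : 2 ≤ n) (y : Fin (2 * n) → K) (i : Fin (2 * n)) :
    AblkE (2 * n) c y i.1 (2 * n) = 0 := by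
  unfold AblkE
  obtain ⟨i, hi⟩ := i
  split_ifs <;> first | omega | simp

theorem corrE_eq (y : Fin (2 * n) → K) (i j : Fin (2 * n)) :
    corrE (2 * n) y i.1 j.1 = ((-1) ^ i.1 * y i) * ((-1) ^ j.1 * y j) *
      (if i.1 < j.1 then (1 : K) else if j.1 < i.1 then -1 else 0) := by
  unfold corrE vW
  rw [dif_pos i.2, dif_pos j.2, pow_add]
  split_ifs <;> ring

end CircuitEntries

section CircuitElimination

variable {K : Type*} [Field K]

/-- The coefficients, up to the signed weight of the vertex `i`, of the combination of the inner
indices that is added to the circuit vertex `i` in order to clear its even inner columns. -/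
def elimCoeff (n : ℕ) (c : Bool) (i j : ℕ) : K :=
  if j % 2 = 1 then
    (if i / 2 ≤ j / 2 then (1 : K) else 0) -
      cond c ((((j / 2 : ℕ) : K) + 1) / n - (if i % 2 = 0 then 1 / (2 * (n : K)) else 0)) (1 / 2)
  else if j = 2 * n then 1 / n else 0

/-- The change of basis within the inner indices of a circuit: the index `2 * l` is replaced by
minus the sum of the even indices up to `2 * l`, except that the last index `2 * n` is replaced
by minus half the sum of the odd indices and takes the place of the index `2 * n - 1`. -/
def elimInner (n : ℕ) (c : Bool) (i j : ℕ) : K :=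
  if i % 2 = 1 then (if j = cond c (if i = 2 * n - 1 then 2 * n else i) i then 1 else 0)
  else if i = 2 * n then (if j % 2 = 1 then -1 / 2 else 0)
  else if j % 2 = 0 ∧ j ≤ i then -1 else 0

variable {n : ℕ} {c : Bool}

theorem elimCoeff_even {q : ℕ} (hq : q < n) (i : ℕ) :
    elimCoeff n c i (2 * q) = (0 : K) := by
  simp [elimCoeff, hq.ne]

theorem elimCoeff_odd (i q : ℕ) :
    elimCoeff n c i (2 * q + 1) = (if i / 2 ≤ q then (1 : K) else 0) -
      cond c (((q : K) + 1) / n - (if i % 2 = 0 then 1 / (2 * (n : K)) else 0)) (1 / 2) := by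
  have h : (2 * q + 1) / 2 = q := by omega
  simp [elimCoeff, h, Nat.add_mod]

theorem elimCoeff_last (i : ℕ) : elimCoeff n c i (2 * n) = (1 / n : K) := by
  simp [elimCoeff]

/-- The entries between the circuit vertices and the inner indices, after the combinations of
inner indices with coefficients `elimCoeff` have been added to the circuit vertices. -/
def elimBlock (n : ℕ) (c : Bool) (y : Fin (2 * n) → K) (i : Fin (2 * n)) (j : ℕ) : K :=
  AblkE (2 * n) c y i.1 j + ∑ j' : Fin (2 * n + cond c 1 0),
    ((-1) ^ i.1 * y i * elimCoeff n c i.1 j'.1) * BblkE (2 * n) c j'.1 j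

theorem elimBlock_even [CharZero K] (hn : 2 ≤ n) (y : Fin (2 * n) → K) (i : Fin (2 * n)) {q : ℕ}
    (hq : q < n) : elimBlock n c y i (2 * q) = 0 := by
  have hcyc : ∀ x : ℕ → K, ∑ r ∈ Finset.range n, x r * ((if q = r then (1 : K) else 0) -
      (if q = r + 1 then (1 : K) else 0) -
        cond c (1 : K) (-1) * (if q = 0 ∧ r = n - 1 then (1 : K) else 0)) =
      x q - (if q = 0 then cond c (1 : K) (-1) * x (n - 1) else x (q - 1)) := by
    intro x
    simp only [mul_sub, Finset.sum_sub_distrib]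
    rcases q with _ | q
    · have : n - 1 < n := by omega
      simp [this, hq, mul_comm]
    · have : q < n := by omega
      simp [hq, this]
  have hn0 : (n : K) ≠ 0 := by simp; omega
  have hi := i.2
  rw [elimBlock, sum_fin_two_mul_add_cond n c fun j' =>
    ((-1) ^ i.1 * y i * elimCoeff n c i.1 j') * BblkE (2 * n) c j' (2 * q),
    AblkE_even, elimCoeff_last, BblkE_last_even hq]
  rw [Finset.sum_congr rfl (g := fun r => ((-1) ^ i.1 * y i * elimCoeff n c i.1 (2 * r + 1)) *
    ((if q = r then (1 : K) else 0) - (if q = r + 1 then (1 : K) else 0) -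
      cond c (1 : K) (-1) * (if q = 0 ∧ r = n - 1 then (1 : K) else 0)))]
  · rw [hcyc fun r => (-1) ^ i.1 * y i * elimCoeff n c i.1 (2 * r + 1)]
    simp only [elimCoeff_odd]
    rcases q with _ | q
    · have h1 : i.1 / 2 ≤ n - 1 := by omega
      have h2 : (((n - 1 : ℕ) : K) + 1) = n := by norm_cast; omega
      simp only [h1, h2, if_true, Nat.le_zero, eq_comm (a := 0)]
      cases c <;> simp only [cond_true, cond_false] <;> split_ifs <;> field_simp <;> ring
    · have h3 : q + 1 - 1 = q := rfl
      simp only [h3, Nat.succ_ne_zero, if_false]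
      rcases lt_trichotomy (i.1 / 2) (q + 1) with h | h | h
      · have h4 : i.1 / 2 ≤ q + 1 := by omega
        have h5 : i.1 / 2 ≤ q := by omega
        have h6 : q + 1 ≠ i.1 / 2 := by omega
        cases c <;> simp [h4, h5, h6]
        split_ifs <;> field_simp <;> ring
      · have h5 : ¬ (q + 1 ≤ q) := by omega
        rw [h]
        cases c <;> simp [h5] <;> (try split_ifs) <;> field_simp <;> ring
      · have h4 : ¬ i.1 / 2 ≤ q + 1 := by omega
        have h5 : ¬ i.1 / 2 ≤ q := by omega
        have h6 : q + 1 ≠ i.1 / 2 := by omega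
        cases c <;> simp [h4, h5, h6]
        split_ifs <;> field_simp <;> ring
  · intro r hr
    have hr := Finset.mem_range.mp hr
    rw [elimCoeff_even hr, BblkE_odd_even hn hq hr]
    ring

theorem elimBlock_odd (y : Fin (2 * n) → K) (i : Fin (2 * n)) {q : ℕ}
    (hq : q < n) : elimBlock n c y i (2 * q + 1) =
      AblkE (2 * n) c y i.1 (2 * q + 1) - cond c ((-1) ^ i.1 * y i * (1 / n)) 0 := by
  rw [elimBlock, sum_fin_two_mul_add_cond n c fun j' =>
    ((-1) ^ i.1 * y i * elimCoeff n c i.1 j') * BblkE (2 * n) c j' (2 * q + 1),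
    elimCoeff_last, BblkE_last_odd hq, Finset.sum_eq_zero]
  · cases c <;> simp; ring
  · intro r hr
    rw [elimCoeff_even (Finset.mem_range.mp hr), BblkE_odd_odd]
    ring

theorem elimBlock_last (hn : 2 ≤ n) (y : Fin (2 * n) → K) (i : Fin (2 * n)) :
    elimBlock n c y i (2 * n) =
      (-1) ^ i.1 * y i * ∑ r ∈ Finset.range n, elimCoeff n c i.1 (2 * r + 1) := by
  rw [elimBlock, sum_fin_two_mul_add_cond n c fun j' =>
    ((-1) ^ i.1 * y i * elimCoeff n c i.1 j') * BblkE (2 * n) c j' (2 * n),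
    AblkE_last hn, BblkE_last_last hn, Finset.mul_sum]
  rw [Finset.sum_congr rfl (g := fun r => (-1) ^ i.1 * y i * elimCoeff n c i.1 (2 * r + 1))]
  · cases c <;> simp
  · intro r hr
    have hr := Finset.mem_range.mp hr
    rw [elimCoeff_even hr, BblkE_odd_last hr]
    ring

end CircuitElimination

section CircuitGram

variable {K : Type*} [Field K] [CharZero K] {n : ℕ} {c : Bool}

theorem sum_elimCoeff_odd (hn : 2 ≤ n) {i : ℕ} (hi : i < 2 * n) :
    ∑ r ∈ Finset.range n, elimCoeff n true i (2 * r + 1) =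
      ((n : K) - (i / 2 : ℕ)) - (n + 1) / 2 + (if i % 2 = 0 then (1 / 2 : K) else 0) := by
  have hn0 : (n : K) ≠ 0 := by simp; omega
  have hgauss : ∀ N : ℕ, ∑ r ∈ Finset.range N, ((r : K) + 1) = N * (N + 1) / 2 := by
    intro N
    induction N with
    | zero => simp
    | succ N ih => rw [Finset.sum_range_succ, ih]; push_cast; ring
  have hind : ∑ r ∈ Finset.range n, (if i / 2 ≤ r then (1 : K) else 0) = n - (i / 2 : ℕ) := by
    have h : (Finset.range n).filter (fun r => i / 2 ≤ r) = Finset.Ico (i / 2) n := by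
      ext r; simp [and_comm]
    rw [Finset.sum_boole, h, Nat.card_Ico, Nat.cast_sub (by omega)]
  simp only [elimCoeff_odd, cond_true, Finset.sum_sub_distrib, hind, ← Finset.sum_div, hgauss,
    Finset.sum_const, Finset.card_range, nsmul_eq_mul]
  split_ifs <;> field_simp <;> ring

theorem sum_elimCoeff_mul_AblkE (hn : 2 ≤ n) (y : Fin (2 * n) → K) (i : Fin (2 * n)) {p : ℕ}
    (hp : p < 2 * n) :
    ∑ r ∈ Finset.range n, elimCoeff n c p (2 * r + 1) * AblkE (2 * n) c y i.1 (2 * r + 1) =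
      (-1) ^ i.1 * y i * (-(if 2 * (p / 2) + 1 ≤ i.1 then (1 : K) else 0) +
        cond c ((((i.1 + 1) / 2 : ℕ) : K) / n - (if p % 2 = 0 then 1 / (2 * (n : K)) else 0))
          (1 / 2)) := by
  have hn0 : (n : K) ≠ 0 := by simp; omega
  have hn1 : n - 1 < n := by omega
  have h2 : (((n - 1 : ℕ) : K) + 1) = n := by norm_cast; omega
  have h3 : p / 2 ≤ n - 1 := by omega
  obtain ⟨i, hi⟩ := i
  rw [Finset.sum_congr rfl fun r hr => by
    rw [AblkE_odd y ⟨i, hi⟩ (Finset.mem_range.mp hr)]]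
  rcases Nat.eq_zero_or_pos i with rfl | h
  · cases c <;> simp [hn1, elimCoeff_odd, h2, h3] <;> (try split_ifs) <;> field_simp <;> norm_num
  · have h4 : (i - 1) / 2 < n := by omega
    have h5 : p / 2 ≤ (i - 1) / 2 ↔ 2 * (p / 2) + 1 ≤ i := by omega
    have h6 : (((i - 1) / 2 : ℕ) : K) + 1 = ((i + 1) / 2 : ℕ) := by norm_cast; omega
    simp only [h.ne', if_false, mul_neg, mul_ite, mul_one, mul_zero, Finset.sum_neg_distrib,
      Finset.sum_ite_eq', Finset.mem_range, h4, if_true, elimCoeff_odd, h5, h6]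
    cases c <;> simp <;> ring

theorem elimBlock_gram (hn : 2 ≤ n) (y : Fin (2 * n) → K) (i p : Fin (2 * n)) :
    -(∑ j : Fin (2 * n + cond c 1 0),
        ((-1) ^ i.1 * y i * elimCoeff n c i.1 j.1) * AblkE (2 * n) c y p.1 j.1) +
      ∑ j : Fin (2 * n + cond c 1 0),
        elimBlock n c y i j.1 * ((-1) ^ p.1 * y p * elimCoeff n c p.1 j.1) =
      corrE (2 * n) y i.1 p.1 := by
  have hn0 : (n : K) ≠ 0 := by simp; omega
  rw [sum_fin_two_mul_add_cond n c fun j =>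
      ((-1) ^ i.1 * y i * elimCoeff n c i.1 j) * AblkE (2 * n) c y p.1 j,
    sum_fin_two_mul_add_cond n c fun j =>
      elimBlock n c y i j * ((-1) ^ p.1 * y p * elimCoeff n c p.1 j),
    AblkE_last hn, elimBlock_last hn, elimCoeff_last]
  rw [Finset.sum_congr rfl (f := fun r => _ + ((-1) ^ i.1 * y i * elimCoeff n c i.1 (2 * r + 1)) *
      AblkE (2 * n) c y p.1 (2 * r + 1)) (g := fun r => (-1) ^ i.1 * y i *
      (elimCoeff n c i.1 (2 * r + 1) * AblkE (2 * n) c y p.1 (2 * r + 1)))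
    (fun r hr => by rw [elimCoeff_even (Finset.mem_range.mp hr)]; ring)]
  rw [Finset.sum_congr rfl (f := fun r => _ + elimBlock n c y i (2 * r + 1) *
      ((-1) ^ p.1 * y p * elimCoeff n c p.1 (2 * r + 1))) (g := fun r => (-1) ^ p.1 * y p *
      (elimCoeff n c p.1 (2 * r + 1) * AblkE (2 * n) c y i.1 (2 * r + 1)) -
      cond c ((-1) ^ i.1 * y i * (1 / n)) 0 * ((-1) ^ p.1 * y p) * elimCoeff n c p.1 (2 * r + 1))
    (fun r hr => by
      rw [elimCoeff_even (Finset.mem_range.mp hr), elimBlock_odd y i (Finset.mem_range.mp hr)]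
      ring)]
  rw [Finset.sum_sub_distrib, ← Finset.mul_sum, ← Finset.mul_sum, ← Finset.mul_sum,
    sum_elimCoeff_mul_AblkE hn y p i.2, sum_elimCoeff_mul_AblkE hn y i p.2, corrE_eq]
  generalize (-1) ^ i.1 * y i = s
  generalize (-1) ^ p.1 * y p = t
  have hord : (if i.1 < p.1 then (1 : K) else if p.1 < i.1 then -1 else 0) =
      (if 2 * (i.1 / 2) + 1 ≤ p.1 then (1 : K) else 0) -
        (if 2 * (p.1 / 2) + 1 ≤ i.1 then (1 : K) else 0) := by
    split_ifs <;> first | omega | simp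
  rw [hord]
  cases c
  · simp
    ring
  · have hdiv : ∀ j : ℕ, (((j + 1) / 2 : ℕ) : K) =
        (j / 2 : ℕ) + 1 - (if j % 2 = 0 then (1 : K) else 0) := by
      intro j
      split_ifs with h
      · rw [add_sub_cancel_right]; norm_cast; omega
      · rw [sub_zero]; norm_cast; omega
    have hite : ∀ j : ℕ, ((if j % 2 = 0 then 1 / (2 * (n : K)) else 0) : K) =
        (if j % 2 = 0 then (1 : K) else 0) / (2 * n) := by
      intro j; split_ifs <;> simp
    have hite' : ∀ j : ℕ, ((if j % 2 = 0 then (1 / 2 : K) else 0) : K) =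
        (if j % 2 = 0 then (1 : K) else 0) / 2 := by
      intro j; split_ifs <;> simp
    rw [sum_elimCoeff_odd hn i.2, sum_elimCoeff_odd hn p.2]
    simp only [cond_true, hdiv, hite, hite', elimCoeff_last]
    field_simp
    ring

theorem elimBlock_mul_last (hn : 2 ≤ n) (y : Fin (2 * n) → K) (i : Fin (2 * n)) :
    ∑ r ∈ Finset.range n, elimBlock n true y i (2 * r + 1) * (-1 / 2) = (-1) ^ i.1 * y i := by
  have hn0 : (n : K) ≠ 0 := by simp; omega
  rw [Finset.sum_congr rfl fun r hr => by
    rw [elimBlock_odd y i (Finset.mem_range.mp hr), AblkE_odd y i (Finset.mem_range.mp hr)]]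
  obtain ⟨i, hi⟩ := i
  have h1 : n - 1 < n := by omega
  have h2 : (i - 1) / 2 < n := by omega
  rw [← Finset.sum_mul, Finset.sum_sub_distrib, ← Finset.mul_sum]
  rcases Nat.eq_zero_or_pos i with rfl | h
  · simp [h1]; field_simp; ring
  · simp [h.ne', h2]; field_simp; ring

end CircuitGram

section CircuitInner

variable {K : Type*} [Field K] {n : ℕ} {c : Bool}

theorem elimInner_even_even {l : ℕ} (hl : l < n) (r : ℕ) :
    elimInner n c (2 * l) (2 * r) = (if r ≤ l then -1 else 0 : K) := by
  simp [elimInner, hl.ne]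

theorem elimInner_even_odd {l : ℕ} (hl : l < n) (r : ℕ) :
    elimInner n c (2 * l) (2 * r + 1) = (0 : K) := by
  simp [elimInner, hl.ne, Nat.add_mod]

theorem elimInner_even_last {l : ℕ} (hl : l < n) : elimInner n c (2 * l) (2 * n) = (0 : K) := by
  simp [elimInner, hl.ne, hl]

theorem elimInner_last_even (r : ℕ) : elimInner n c (2 * n) (2 * r) = (0 : K) := by
  simp [elimInner]

theorem elimInner_last_odd (r : ℕ) : elimInner n c (2 * n) (2 * r + 1) = (-1 / 2 : K) := by
  simp [elimInner, Nat.add_mod]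

theorem sum_elimInner_odd_mul {l : ℕ} (hl : l < n) (f : ℕ → K) :
    ∑ j : Fin (2 * n + cond c 1 0), elimInner n c (2 * l + 1) j.1 * f j.1 =
      f (cond c (if l = n - 1 then 2 * n else 2 * l + 1) (2 * l + 1)) := by
  have h1 : (2 * l + 1) % 2 = 1 := by omega
  have h2 : 2 * l + 1 = 2 * n - 1 ↔ l = n - 1 := by omega
  have h3 : cond c (if l = n - 1 then 2 * n else 2 * l + 1) (2 * l + 1) < 2 * n + cond c 1 0 := by
    cases c <;> simp only [cond_true, cond_false] <;> (try split_ifs) <;> omega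
  rw [Finset.sum_eq_single ⟨_, h3⟩]
  · simp [elimInner, h1, h2]
  · intro j _ hj
    simp only [elimInner, h1, h2, if_true]
    rw [if_neg fun h => hj (Fin.ext h), zero_mul]
  · simp

theorem sum_elimBlock_mul_elimInner_even [CharZero K] (hn : 2 ≤ n) (y : Fin (2 * n) → K)
    (i : Fin (2 * n)) {l : ℕ} (hl : l < n) :
    ∑ j : Fin (2 * n + cond c 1 0), elimBlock n c y i j.1 * elimInner n c (2 * l) j.1 = 0 := by
  rw [sum_fin_two_mul_add_cond n c fun j => elimBlock n c y i j * elimInner n c (2 * l) j,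
    elimInner_even_last hl, Finset.sum_eq_zero]
  · cases c <;> simp
  · intro r hr
    rw [elimBlock_even hn y i (Finset.mem_range.mp hr), elimInner_even_odd hl]
    ring

theorem sum_elimBlock_mul_elimInner_last [CharZero K] (hn : 2 ≤ n) (y : Fin (2 * n) → K)
    (i : Fin (2 * n)) :
    ∑ j : Fin (2 * n + cond true 1 0), elimBlock n true y i j.1 * elimInner n true (2 * n) j.1 =
      (-1) ^ i.1 * y i := by
  rw [sum_fin_two_mul_add_cond n true fun j => elimBlock n true y i j * elimInner n true (2 * n) j]
  simp [elimInner_last_even, elimInner_last_odd, elimBlock_mul_last hn]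

/-- The pairing of the inner index `j` with the combination of inner indices that replaces the
even inner index `i`. -/
def innerPairing (n : ℕ) (c : Bool) (i j : ℕ) : K :=
  ∑ j' : Fin (2 * n + cond c 1 0), BblkE (2 * n) c j j'.1 * elimInner n c i j'.1

theorem innerPairing_eq_sum {l : ℕ} (hl : l < n) (j : ℕ) :
    innerPairing n c (2 * l) j =
      -∑ r ∈ Finset.range (l + 1), (BblkE (2 * n) c j (2 * r) : K) := by
  rw [innerPairing, sum_fin_two_mul_add_cond n c fun j' =>
    BblkE (2 * n) c j j' * elimInner n c (2 * l) j', elimInner_even_last hl]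
  simp only [elimInner_even_odd hl, elimInner_even_even hl, mul_zero, add_zero]
  have h : (Finset.range n).filter (fun r => r ≤ l) = Finset.range (l + 1) := by
    ext r; simp; omega
  simp only [mul_ite, mul_neg, mul_one, mul_zero, ← Finset.sum_filter, h, Finset.sum_neg_distrib]
  cases c <;> simp

theorem innerPairing_even (hn : 2 ≤ n) {l s : ℕ} (hl : l < n) (hs : s < n) :
    innerPairing n c (2 * l) (2 * s) = (0 : K) := by
  rw [innerPairing_eq_sum hl, Finset.sum_eq_zero, neg_zero]
  intro r hr
  have := Finset.mem_range.mp hr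
  exact BblkE_even_even hn hs (by omega)

theorem innerPairing_odd (hn : 2 ≤ n) {l s : ℕ} (hl : l < n) (hs : s < n) :
    innerPairing n c (2 * l) (2 * s + 1) =
      -(if s = l then (1 : K) else 0) +
        cond c (1 : K) (-1) * (if s = n - 1 then (1 : K) else 0) := by
  rw [innerPairing_eq_sum hl, Finset.sum_congr rfl fun r hr => by
    rw [BblkE_odd_even hn (r := r) (by have := Finset.mem_range.mp hr; omega) hs]]
  simp only [Finset.sum_sub_distrib, ← Finset.mul_sum, Finset.sum_ite_eq', Finset.mem_range]
  rw [Finset.sum_eq_single_of_mem 0 (by simp) (by intro r _ hr; simp [hr])]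
  split_ifs <;> first | omega | (simp_all <;> ring)

theorem innerPairing_last {l : ℕ} (hl : l < n) :
    innerPairing n c (2 * l) (2 * n) = -((l : K) + 1) := by
  rw [innerPairing_eq_sum hl, Finset.sum_congr rfl fun r hr => by
    rw [BblkE_last_even (r := r) (by have := Finset.mem_range.mp hr; omega)]]
  simp

theorem sum_elimInner_even_mul_innerPairing (hn : 2 ≤ n) {l l' : ℕ} (hl : l < n) (hl' : l' < n) :
    ∑ j : Fin (2 * n + cond c 1 0), elimInner n c (2 * l') j.1 * innerPairing n c (2 * l) j.1 =
      (0 : K) := by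
  rw [sum_fin_two_mul_add_cond n c fun j => elimInner n c (2 * l') j * innerPairing n c (2 * l) j,
    elimInner_even_last hl', Finset.sum_eq_zero]
  · cases c <;> simp
  · intro r hr
    rw [elimInner_even_odd hl', innerPairing_even hn hl (Finset.mem_range.mp hr)]
    ring

theorem sum_elimInner_last_mul_innerPairing (hn : 2 ≤ n) {l : ℕ} (hl : l < n) :
    ∑ j : Fin (2 * n + cond true 1 0),
      elimInner n true (2 * n) j.1 * innerPairing n true (2 * l) j.1 = (0 : K) := by
  have h1 : n - 1 < n := by omega
  rw [sum_fin_two_mul_add_cond n true fun j =>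
    elimInner n true (2 * n) j * innerPairing n true (2 * l) j]
  rw [Finset.sum_congr rfl (fun r hr => by
    rw [elimInner_last_even, elimInner_last_odd,
      innerPairing_odd hn hl (Finset.mem_range.mp hr)])]
  simp [elimInner_last_even, ← Finset.mul_sum, Finset.sum_add_distrib, hl, h1]

theorem sum_elimInner_odd_mul_innerPairing_of_lt (hn : 2 ≤ n) {l l' : ℕ} (hl : l < n)
    (hl' : l' < l) :
    ∑ j : Fin (2 * n + cond c 1 0), elimInner n c (2 * l' + 1) j.1 * innerPairing n c (2 * l) j.1 =
      (0 : K) := by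
  have h1 : l' ≠ n - 1 := by omega
  rw [sum_elimInner_odd_mul (by omega) (innerPairing n c (2 * l)), if_neg h1, Bool.cond_self,
    innerPairing_odd hn hl (by omega)]
  simp [h1, hl'.ne]

theorem sum_elimInner_odd_mul_innerPairing_self (hn : 2 ≤ n) {l : ℕ} (hl : l < n) :
    ∑ j : Fin (2 * n + cond c 1 0), elimInner n c (2 * l + 1) j.1 * innerPairing n c (2 * l) j.1 =
      -(if l = n - 1 then cond c (n : K) 2 else 1) := by
  rw [sum_elimInner_odd_mul hl (innerPairing n c (2 * l))]
  have h2 : l = n - 1 → (l : K) + 1 = n := fun h => by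
    exact_mod_cast congrArg (Nat.cast : ℕ → K) (by omega : l + 1 = n)
  cases c <;> simp only [cond_true, cond_false] <;> split_ifs with h
  · rw [innerPairing_odd hn hl hl]; simp [h]; norm_num
  · rw [innerPairing_odd hn hl hl]; simp [h]
  · rw [innerPairing_last hl, h2 h]
  · rw [innerPairing_odd hn hl hl]; simp [h]

/-- The matrix with entries `elimInner`. -/
def elimInnerMatrix (n : ℕ) (c : Bool) :
    Matrix (Fin (2 * n + cond c 1 0)) (Fin (2 * n + cond c 1 0)) K :=
  Matrix.of fun i j => elimInner n c i.1 j.1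

theorem det_elimInnerMatrix (hn : 2 ≤ n) :
    (elimInnerMatrix n c : Matrix _ _ K).det = (-1) ^ n * cond c (1 / 2) 1 := by
  have hdiag : ∀ l < n, elimInner n c (2 * l) (2 * l) = (-1 : K) := fun l hl => by
    rw [elimInner_even_even hl, if_pos le_rfl]
  have hprod : ∀ f : ℕ → K, ∏ j ∈ Finset.range (2 * n), f j =
      ∏ r ∈ Finset.range n, f (2 * r) * f (2 * r + 1) := fun f => prod_range_double f n
  cases c
  · rw [Matrix.det_of_isLowerTriangular]
    · simp only [elimInnerMatrix, Matrix.of_apply]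
      rw [Fin.prod_univ_eq_prod_range (fun i => elimInner n false i i : ℕ → K)]
      simp only [cond_false, add_zero, hprod]
      rw [Finset.prod_congr rfl (g := fun _ => -1)]
      · simp
      · intro r hr
        rw [hdiag r (Finset.mem_range.mp hr)]
        simp [elimInner, Nat.add_mod]
    · intro i j hij
      have hij : i.1 < j.1 := hij
      have hj := j.2
      simp only [elimInnerMatrix, Matrix.of_apply, elimInner, cond_false] at hj ⊢
      split_ifs <;> first | rfl | omega
  · set p : Fin (2 * n + cond true 1 0) := ⟨2 * n - 1, by omega⟩ with hp
    set q : Fin (2 * n + cond true 1 0) := ⟨2 * n, by simp⟩ with hq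
    have hpq : p ≠ q := by simp [hp, hq]; omega
    have hperm := Matrix.det_permute (Equiv.swap p q) (elimInnerMatrix n true : Matrix _ _ K)
    have hval : ∀ i, (Equiv.swap p q i).1 =
        if i.1 = 2 * n - 1 then 2 * n else if i.1 = 2 * n then 2 * n - 1 else i.1 := by
      intro i
      rw [Equiv.swap_apply_def]
      simp only [Fin.ext_iff, hp, hq]
      split_ifs <;> rfl
    rw [Equiv.Perm.sign_swap hpq, Matrix.det_of_isLowerTriangular] at hperm
    · simp only [elimInnerMatrix, Matrix.submatrix_apply, Matrix.of_apply, id, hval] at hperm ⊢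
      rw [Fin.prod_univ_eq_prod_range (fun i => elimInner n true
        (if i = 2 * n - 1 then 2 * n else if i = 2 * n then 2 * n - 1 else i) i : ℕ → K),
        cond_true, Finset.prod_range_succ, hprod,
        Finset.prod_congr rfl (g := fun r => if r = n - 1 then (1 / 2 : K) else -1)] at hperm
      · obtain ⟨k, rfl⟩ : ∃ k, n = k + 1 := ⟨n - 1, by omega⟩
        have h1 : (2 * (k + 1) - 1) % 2 = 1 := by omega
        have h2 : 2 * (k + 1) ≠ 2 * (k + 1) - 1 := by omega
        have h3 : elimInner (k + 1) true (2 * (k + 1) - 1) (2 * (k + 1)) = (1 : K) := by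
          simp [elimInner, h1]
        rw [if_neg h2, if_pos rfl, h3, Finset.prod_range_succ,
          Finset.prod_congr rfl (g := fun _ => (-1 : K))] at hperm
        · simp only [Finset.prod_const, Finset.card_range, add_tsub_cancel_right, if_true,
            Units.val_neg,
            Units.val_one, Int.cast_neg, Int.cast_one] at hperm
          have h4 : ∀ d : K, (-1) ^ k * (1 / 2) * 1 = -1 * d → d = (-1) ^ (k + 1) * (1 / 2) :=
            fun d h => by rw [pow_succ]; linear_combination h
          exact h4 _ hperm
        · intro r hr
          have := Finset.mem_range.mp hr
          rw [if_neg (by omega)]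
      · intro r hr
        have hr := Finset.mem_range.mp hr
        have h1 : 2 * r ≠ 2 * n - 1 := by omega
        have h2 : 2 * r ≠ 2 * n := by omega
        have h3 : 2 * r + 1 ≠ 2 * n := by omega
        have h4 : 2 * r + 1 = 2 * n - 1 ↔ r = n - 1 := by omega
        rw [if_neg h1, if_neg h2, hdiag r hr, if_neg h3]
        simp only [h4]
        split_ifs with h
        · rw [elimInner_last_odd]; ring
        · simp [elimInner, Nat.add_mod, h4, h]
    · intro i j hij
      have hij : i.1 < j.1 := hij
      have hi : i.1 < 2 * n + 1 := i.2
      have hj : j.1 < 2 * n + 1 := j.2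
      simp only [elimInnerMatrix, Matrix.submatrix_apply, Matrix.of_apply, elimInner, id, hval,
        cond_true]
      split_ifs <;> first | rfl | omega

end CircuitInner

theorem apply_eq_neg_of_transpose_eq_neg {ι R : Type*} [Neg R] {A : Matrix ι ι R} (h : Aᵀ = -A)
    (i j : ι) : A i j = -A j i :=
  congrFun (congrFun h j) i

section CircuitMatrix

variable {K : Type*} [Field K] {n : ℕ} {c : Bool}

/-- The part of the big matrix that comes from one circuit. -/
def circuitMatrix (n : ℕ) (c : Bool) (y : Fin (2 * n) → K) :
    Matrix (Fin (2 * n) ⊕ Fin (2 * n + cond c 1 0)) (Fin (2 * n) ⊕ Fin (2 * n + cond c 1 0)) K :=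
  Matrix.fromBlocks 0 (Matrix.of fun i j => AblkE (2 * n) c y i.1 j.1)
    (-(Matrix.of fun i j => AblkE (2 * n) c y i.1 j.1)ᵀ)
    (Matrix.of fun i j => BblkE (2 * n) c i.1 j.1)

/-- The change of basis that clears the even inner indices of one circuit. -/
def elimMatrix (n : ℕ) (c : Bool) (y : Fin (2 * n) → K) :
    Matrix (Fin (2 * n) ⊕ Fin (2 * n + cond c 1 0)) (Fin (2 * n) ⊕ Fin (2 * n + cond c 1 0)) K :=
  Matrix.fromBlocks 1 (Matrix.of fun i j => (-1) ^ i.1 * y i * elimCoeff n c i.1 j.1) 0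
    (elimInnerMatrix n c)

/-- The matrix of one circuit after the change of basis `elimMatrix`. -/
def elimGram (n : ℕ) (c : Bool) (y : Fin (2 * n) → K) :
    Matrix (Fin (2 * n) ⊕ Fin (2 * n + cond c 1 0)) (Fin (2 * n) ⊕ Fin (2 * n + cond c 1 0)) K :=
  elimMatrix n c y * circuitMatrix n c y * (elimMatrix n c y)ᵀ

theorem det_elimMatrix (hn : 2 ≤ n) (y : Fin (2 * n) → K) :
    (elimMatrix n c y).det = (-1) ^ n * cond c (1 / 2) 1 := by
  rw [elimMatrix, Matrix.det_fromBlocks_zero₂₁, Matrix.det_one, one_mul, det_elimInnerMatrix hn]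

theorem transpose_circuitMatrix (hn : 2 ≤ n) (y : Fin (2 * n) → K) :
    (circuitMatrix n c y)ᵀ = -circuitMatrix n c y := by
  ext (i | i) (j | j) <;> simp [circuitMatrix]
  exact BblkE_antisymm hn _ _

theorem elimGram_antisymm (hn : 2 ≤ n) (y : Fin (2 * n) → K)
    (u v : Fin (2 * n) ⊕ Fin (2 * n + cond c 1 0)) :
    elimGram n c y u v = -elimGram n c y v u :=
  apply_eq_neg_of_transpose_eq_neg (by
    simp [elimGram, Matrix.transpose_mul, transpose_circuitMatrix hn, Matrix.mul_assoc]) u v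

theorem elimGram_inl_inr (y : Fin (2 * n) → K) (i : Fin (2 * n)) (u : Fin (2 * n + cond c 1 0)) :
    elimGram n c y (Sum.inl i) (Sum.inr u) =
      ∑ j : Fin (2 * n + cond c 1 0), elimBlock n c y i j.1 * elimInner n c u.1 j.1 := by
  simp [elimGram, elimMatrix, circuitMatrix, Matrix.fromBlocks_transpose,
    Matrix.fromBlocks_multiply, Matrix.mul_apply, elimBlock, elimInnerMatrix]

theorem elimGram_inl_inl [CharZero K] (hn : 2 ≤ n) (y : Fin (2 * n) → K) (i p : Fin (2 * n)) :
    elimGram n c y (Sum.inl i) (Sum.inl p) = corrE (2 * n) y i.1 p.1 := by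
  rw [← elimBlock_gram (c := c) hn y i p]
  simp [elimGram, elimMatrix, circuitMatrix, Matrix.fromBlocks_transpose,
    Matrix.fromBlocks_multiply, Matrix.mul_apply, elimBlock, Matrix.one_apply]

theorem elimGram_inr_inr (y : Fin (2 * n) → K) (u v : Fin (2 * n + cond c 1 0)) :
    elimGram n c y (Sum.inr u) (Sum.inr v) =
      ∑ j : Fin (2 * n + cond c 1 0), elimInner n c u.1 j.1 * innerPairing n c v.1 j.1 := by
  simp only [elimGram, elimMatrix, circuitMatrix, Matrix.fromBlocks_transpose,
    Matrix.fromBlocks_multiply, Matrix.fromBlocks_apply₂₂, Matrix.zero_mul, Matrix.mul_zero,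
    zero_add, Matrix.transpose_zero, Matrix.mul_assoc]
  simp [Matrix.mul_apply, elimInnerMatrix, innerPairing]

theorem elimGram_pair_pair (hn : 2 ≤ n) (y : Fin (2 * n) → K) {l l' : Fin n} (h : l' < l)
    (a : Fin 2) :
    elimGram n c y (circuitSplitEquiv n (cond c 1 0) (Sum.inr (l', a)))
      (circuitSplitEquiv n (cond c 1 0) (Sum.inr (l, 0))) = 0 := by
  rw [circuitSplitEquiv_inr, circuitSplitEquiv_inr, elimGram_inr_inr]
  fin_cases a
  · exact sum_elimInner_even_mul_innerPairing hn l.2 l'.2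
  · exact sum_elimInner_odd_mul_innerPairing_of_lt hn l.2 h

theorem elimGram_pair (hn : 2 ≤ n) (y : Fin (2 * n) → K) (l : Fin n) :
    elimGram n c y (circuitSplitEquiv n (cond c 1 0) (Sum.inr (l, 0)))
      (circuitSplitEquiv n (cond c 1 0) (Sum.inr (l, 1))) =
      if l.1 = n - 1 then cond c (n : K) 2 else 1 := by
  rw [elimGram_antisymm hn, circuitSplitEquiv_inr, circuitSplitEquiv_inr, elimGram_inr_inr,
    neg_eq_iff_eq_neg]
  exact sum_elimInner_odd_mul_innerPairing_self hn l.2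

variable [CharZero K]

theorem elimGram_self (hn : 2 ≤ n) (y : Fin (2 * n) → K)
    (u : Fin (2 * n) ⊕ Fin (2 * n + cond c 1 0)) : elimGram n c y u u = 0 :=
  self_eq_neg.mp (elimGram_antisymm hn y u u)

theorem elimGram_vertex_vertex (hn : 2 ≤ n) (y : Fin (2 * n) → K)
    (i p : Fin (2 * n + cond c 1 0)) :
    elimGram n c y (circuitSplitEquiv n (cond c 1 0) (Sum.inl i))
      (circuitSplitEquiv n (cond c 1 0) (Sum.inl p)) = corrE (2 * n) y i.1 p.1 := by
  have hlast : ∀ i : Fin (2 * n), ∀ p : Fin (2 * n + cond c 1 0), ¬ p.1 < 2 * n →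
      elimGram n c y (Sum.inl i) (Sum.inr p) = corrE (2 * n) y i.1 p.1 := by
    intro i p hp
    have hp2 := p.2
    cases c
    · exact absurd hp2 hp
    · have hp : p.1 = 2 * n := by simp at hp2; omega
      rw [elimGram_inl_inr, hp, sum_elimBlock_mul_elimInner_last hn]
      simp [corrE, vW, pow_add]
  by_cases hi : i.1 < 2 * n <;> by_cases hp : p.1 < 2 * n
  · rw [circuitSplitEquiv_inl_of_lt i hi, circuitSplitEquiv_inl_of_lt p hp, elimGram_inl_inl hn]
  · rw [circuitSplitEquiv_inl_of_lt i hi, circuitSplitEquiv_inl_of_not_lt p hp, hlast _ _ hp]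
  · rw [circuitSplitEquiv_inl_of_not_lt i hi, circuitSplitEquiv_inl_of_lt p hp,
      elimGram_antisymm hn, hlast _ _ hi]
    simp only [corrE]
    split_ifs <;> first | omega | (rw [add_comm]; ring)
  · obtain rfl : i = p := by
      have hi2 := i.2
      have hp2 := p.2
      cases c <;> simp only [cond_true, cond_false] at hi2 hp2 <;> exact Fin.ext (by omega)
    rw [elimGram_self hn]
    simp [corrE]

theorem elimGram_vertex_pair (hn : 2 ≤ n) (y : Fin (2 * n) → K)
    (i : Fin (2 * n + cond c 1 0)) (l : Fin n) :
    elimGram n c y (circuitSplitEquiv n (cond c 1 0) (Sum.inl i))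
      (circuitSplitEquiv n (cond c 1 0) (Sum.inr (l, 0))) = 0 := by
  rw [circuitSplitEquiv_inr]
  by_cases hi : i.1 < 2 * n
  · rw [circuitSplitEquiv_inl_of_lt i hi, elimGram_inl_inr]
    exact sum_elimBlock_mul_elimInner_even hn y _ l.2
  · rw [circuitSplitEquiv_inl_of_not_lt i hi, elimGram_inr_inr]
    have hi2 := i.2
    cases c
    · exact absurd hi2 hi
    · have hi : i.1 = 2 * n := by simp at hi2; omega
      rw [hi]
      exact sum_elimInner_last_mul_innerPairing hn l.2

theorem prod_elimGram_pair (hn : 2 ≤ n) (y : Fin (2 * n) → K) :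
    ∏ l : Fin n, elimGram n c y (circuitSplitEquiv n (cond c 1 0) (Sum.inr (l, 0)))
      (circuitSplitEquiv n (cond c 1 0) (Sum.inr (l, 1))) =
      (elimMatrix n c y).det * ((-1) ^ n * cond c (2 * n : K) 2) := by
  rw [Finset.prod_congr rfl fun l _ => elimGram_pair hn y l,
    Fin.prod_univ_eq_prod_range (fun l => if l = n - 1 then cond c (n : K) 2 else 1),
    Finset.prod_ite_eq' , if_pos (Finset.mem_range.mpr (by omega)), det_elimMatrix hn]
  have h : ((-1) ^ n * (-1) ^ n : K) = 1 := by rw [← mul_pow]; simp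
  cases c <;> simp only [cond_true, cond_false]
  · linear_combination -2 * h
  · linear_combination -(n : K) * h

end CircuitMatrix

theorem det_blockDiagonal_sigma {R α : Type*} [CommRing R] [Fintype α] [LinearOrder α]
    {m : α → Type*} [∀ k, Fintype (m k)] [∀ k, DecidableEq (m k)]
    (M : ∀ k, Matrix (m k) (m k) R) :
    (Matrix.blockDiagonal' M).det = ∏ k, (M k).det := by
  rw [(Matrix.blockTriangular_blockDiagonal' M).det_fintype]
  refine Finset.prod_congr rfl fun k _ => ?_
  have he : Function.Bijective
      (fun i => ⟨⟨k, i⟩, rfl⟩ : m k → {a : Σ k, m k // a.1 = k}) := by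
    constructor
    · intro i j h
      simpa using h
    · rintro ⟨⟨l, i⟩, rfl⟩
      exact ⟨i, rfl⟩
  rw [← Matrix.det_submatrix_equiv_self (Equiv.ofBijective _ he)]
  congr 1
  ext i j
  simp [Matrix.toSquareBlock_def]

section GlobalElimination

variable {K : Type*} [Field K] {b : ℕ} (n : Fin b → ℕ) (m : ℕ) (β : Fin b → Bool)

/-- The inclusion of the original indices into those of the big matrix. -/
def originalIncl : (Σ k : Fin b, Fin (2 * n k)) ⊕ Fin m →
    (Σ k : Fin b, Fin (2 * n k) ⊕ Fin (2 * n k + cond (β k) 1 0)) ⊕ Fin m :=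
  Sum.map (fun p => ⟨p.1, Sum.inl p.2⟩) id

variable (K) in
/-- The matrix of `originalIncl`. -/
def originalMatrix : Matrix ((Σ k : Fin b, Fin (2 * n k) ⊕ Fin (2 * n k + cond (β k) 1 0)) ⊕ Fin m)
    ((Σ k : Fin b, Fin (2 * n k)) ⊕ Fin m) K :=
  (1 : Matrix _ _ K).submatrix id (originalIncl n m β)

/-- The matrix on the big index set made of one diagonal block per circuit. -/
def circuitsMatrix (G : ∀ k, Matrix (Fin (2 * n k) ⊕ Fin (2 * n k + cond (β k) 1 0))
      (Fin (2 * n k) ⊕ Fin (2 * n k + cond (β k) 1 0)) K) (D : Matrix (Fin m) (Fin m) K) :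
    Matrix ((Σ k : Fin b, Fin (2 * n k) ⊕ Fin (2 * n k + cond (β k) 1 0)) ⊕ Fin m)
      ((Σ k : Fin b, Fin (2 * n k) ⊕ Fin (2 * n k + cond (β k) 1 0)) ⊕ Fin m) K :=
  Matrix.fromBlocks (Matrix.blockDiagonal' G) 0 0 D

variable {n m β} (W : Matrix ((Σ k : Fin b, Fin (2 * n k)) ⊕ Fin m)
  ((Σ k : Fin b, Fin (2 * n k)) ⊕ Fin m) K)

variable (β) in
/-- The matrix `W` on the original indices, extended by zero to the big index set. -/
def extendByZero :
    Matrix ((Σ k : Fin b, Fin (2 * n k) ⊕ Fin (2 * n k + cond (β k) 1 0)) ⊕ Fin m)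
      ((Σ k : Fin b, Fin (2 * n k) ⊕ Fin (2 * n k + cond (β k) 1 0)) ⊕ Fin m) K :=
  originalMatrix K n m β * W * (originalMatrix K n m β)ᵀ

theorem originalIncl_injective : Function.Injective (originalIncl n m β) := by
  rintro (⟨k, i⟩ | s) (⟨l, j⟩ | t) h <;> simp [originalIncl] at h
  · obtain ⟨rfl, h⟩ := h
    simp at h
    rw [h]
  · rw [h]

theorem extendByZero_apply_incl (v w : (Σ k : Fin b, Fin (2 * n k)) ⊕ Fin m) :
    extendByZero β W (originalIncl n m β v)
      (originalIncl n m β w) = W v w := by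
  simp [extendByZero, originalMatrix, Matrix.mul_apply, Matrix.one_apply,
    originalIncl_injective.eq_iff]

theorem extendByZero_apply_inner_left (k : Fin b) (j : Fin (2 * n k + cond (β k) 1 0))
    (q : (Σ k : Fin b, Fin (2 * n k) ⊕ Fin (2 * n k + cond (β k) 1 0)) ⊕ Fin m) :
    extendByZero β W (Sum.inl ⟨k, Sum.inr j⟩) q = 0 := by
  rw [extendByZero, Matrix.mul_assoc, Matrix.mul_apply, Finset.sum_eq_zero]
  rintro (⟨l, i⟩ | t) _ <;>
    simp only [originalMatrix, Matrix.submatrix_apply, originalIncl]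
  · rw [Matrix.one_apply_ne, zero_mul]
    rintro h
    simp at h
    obtain ⟨rfl, h⟩ := h
    simp at h
  · rw [Matrix.one_apply_ne (by simp), zero_mul]

theorem transpose_extendByZero : (extendByZero β W)ᵀ = extendByZero β Wᵀ := by
  simp [extendByZero, Matrix.transpose_mul, Matrix.mul_assoc]

theorem extendByZero_apply_inner_right (k : Fin b) (j : Fin (2 * n k + cond (β k) 1 0))
    (q : (Σ k : Fin b, Fin (2 * n k) ⊕ Fin (2 * n k + cond (β k) 1 0)) ⊕ Fin m) :
    extendByZero β W q (Sum.inl ⟨k, Sum.inr j⟩) = 0 := by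
  rw [← extendByZero_apply_inner_left Wᵀ k j q, ← transpose_extendByZero, Matrix.transpose_apply]

theorem bigA_eq (y : (k : Fin b) → Fin (2 * n k) → K) :
    bigA b m (fun k => 2 * n k) β y W =
      extendByZero β W +
        circuitsMatrix n m β (fun k => circuitMatrix (n k) (β k) (y k)) 0 := by
  have hincl := extendByZero_apply_incl (β := β) W
  ext (⟨k, i | i⟩ | s) (⟨l, j | j⟩ | t) <;> rw [Matrix.add_apply]
  · have h := hincl (Sum.inl ⟨k, i⟩) (Sum.inl ⟨l, j⟩)
    rw [originalIncl, Sum.map_inl, Sum.map_inl] at h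
    rw [h]
    by_cases hkl : k = l
    · subst hkl; simp [bigA, circuitsMatrix, circuitMatrix]
    · simp [bigA, circuitsMatrix, Matrix.blockDiagonal'_apply_ne _ _ _ hkl]
  · rw [extendByZero_apply_inner_right]
    by_cases hkl : k = l
    · subst hkl; simp [bigA, circuitsMatrix, circuitMatrix]
    · simp [bigA, circuitsMatrix, Matrix.blockDiagonal'_apply_ne _ _ _ hkl, hkl]
  · have h := hincl (Sum.inl ⟨k, i⟩) (Sum.inr t)
    rw [originalIncl, Sum.map_inl, Sum.map_inr] at h
    simpa [bigA, circuitsMatrix] using h.symm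
  · rw [extendByZero_apply_inner_left]
    by_cases hkl : k = l
    · subst hkl; simp [bigA, circuitsMatrix, circuitMatrix]
    · simp [bigA, circuitsMatrix, Matrix.blockDiagonal'_apply_ne _ _ _ hkl, hkl]
  · rw [extendByZero_apply_inner_right]
    by_cases hkl : k = l
    · subst hkl; simp [bigA, circuitsMatrix, circuitMatrix]
    · simp [bigA, circuitsMatrix, Matrix.blockDiagonal'_apply_ne _ _ _ hkl, hkl]
  · rw [extendByZero_apply_inner_left]
    simp [bigA, circuitsMatrix]
  · have h := hincl (Sum.inr s) (Sum.inl ⟨l, j⟩)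
    rw [originalIncl, Sum.map_inl, Sum.map_inr] at h
    simpa [bigA, circuitsMatrix] using h.symm
  · rw [extendByZero_apply_inner_right]
    simp [bigA, circuitsMatrix]
  · have h := hincl (Sum.inr s) (Sum.inr t)
    rw [originalIncl, Sum.map_inr, Sum.map_inr] at h
    simpa [bigA, circuitsMatrix] using h.symm

theorem bigA_antisymm (hn : ∀ k, 2 ≤ n k) (hW : Wᵀ = -W) (y : (k : Fin b) → Fin (2 * n k) → K) :
    (bigA b m (fun k => 2 * n k) β y W)ᵀ = -bigA b m (fun k => 2 * n k) β y W := by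
  have h : (fun k => (circuitMatrix (n k) (β k) (y k))ᵀ) =
      -fun k => circuitMatrix (n k) (β k) (y k) :=
    funext fun k => transpose_circuitMatrix (hn k) (y k)
  rw [bigA_eq, Matrix.transpose_add, neg_add]
  congr 1
  · rw [transpose_extendByZero, hW]
    simp [extendByZero]
  · simp [circuitsMatrix, Matrix.fromBlocks_transpose, Matrix.blockDiagonal'_transpose, h,
      Matrix.fromBlocks_neg]

/-- The change of basis that clears the even inner indices of all circuits. -/
def elimGlobal (n : Fin b → ℕ) (m : ℕ) (β : Fin b → Bool) (y : (k : Fin b) → Fin (2 * n k) → K) :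
    Matrix ((Σ k : Fin b, Fin (2 * n k) ⊕ Fin (2 * n k + cond (β k) 1 0)) ⊕ Fin m)
      ((Σ k : Fin b, Fin (2 * n k) ⊕ Fin (2 * n k + cond (β k) 1 0)) ⊕ Fin m) K :=
  circuitsMatrix n m β (fun k => elimMatrix (n k) (β k) (y k)) 1

theorem elimGlobal_mul_originalMatrix (y : (k : Fin b) → Fin (2 * n k) → K) :
    elimGlobal n m β y * originalMatrix K n m β = originalMatrix K n m β := by
  rw [originalMatrix, ← Equiv.coe_refl, Matrix.mul_submatrix_one]
  ext (⟨k, i⟩ | s) (⟨l, j⟩ | t)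
  · by_cases hkl : k = l
    · subst hkl
      rcases i with i | i <;>
        simp [elimGlobal, circuitsMatrix, originalIncl, elimMatrix, Matrix.one_apply]
    · simp [elimGlobal, circuitsMatrix, originalIncl, Matrix.blockDiagonal'_apply_ne _ _ _ hkl,
        Matrix.one_apply, hkl]
  · simp [elimGlobal, circuitsMatrix, originalIncl, Matrix.one_apply]
  · simp [elimGlobal, circuitsMatrix, originalIncl, Matrix.one_apply]
  · simp [elimGlobal, circuitsMatrix, originalIncl, Matrix.one_apply]

theorem elimGlobal_mul_bigA_mul (y : (k : Fin b) → Fin (2 * n k) → K) :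
    elimGlobal n m β y * bigA b m (fun k => 2 * n k) β y W * (elimGlobal n m β y)ᵀ =
      extendByZero β W +
        circuitsMatrix n m β (fun k => elimGram (n k) (β k) (y k)) 0 := by
  rw [bigA_eq, Matrix.mul_add, Matrix.add_mul]
  congr 1
  · rw [extendByZero, ← Matrix.mul_assoc, ← Matrix.mul_assoc, elimGlobal_mul_originalMatrix,
      Matrix.mul_assoc,
      ← Matrix.transpose_mul, elimGlobal_mul_originalMatrix]
  · simp [elimGlobal, circuitsMatrix, Matrix.fromBlocks_transpose, Matrix.fromBlocks_multiply,
      Matrix.blockDiagonal'_transpose, ← Matrix.blockDiagonal'_mul, elimGram]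

theorem det_elimGlobal (y : (k : Fin b) → Fin (2 * n k) → K) :
    (elimGlobal n m β y).det = ∏ k, (elimMatrix (n k) (β k) (y k)).det := by
  rw [elimGlobal, circuitsMatrix, Matrix.det_fromBlocks_zero₂₁, Matrix.det_one, mul_one,
    det_blockDiagonal_sigma]

end GlobalElimination

section FieldCase

variable {K : Type*} [Field K] {b : ℕ} {n : Fin b → ℕ} {m : ℕ} {β : Fin b → Bool}

theorem submatrix_splitEquiv_inl [CharZero K] (hn : ∀ k, 2 ≤ n k)
    (W : Matrix ((Σ k : Fin b, Fin (2 * n k)) ⊕ Fin m) ((Σ k : Fin b, Fin (2 * n k)) ⊕ Fin m) K)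
    (y : (k : Fin b) → Fin (2 * n k) → K) :
    (extendByZero β W + circuitsMatrix n m β (fun k => elimGram (n k) (β k) (y k)) 0).submatrix
      (fun x => splitEquiv n (fun k => cond (β k) 1 0) m (Sum.inl x))
      (fun x => splitEquiv n (fun k => cond (β k) 1 0) m (Sum.inl x)) =
      bigM b m (fun k => 2 * n k) β y W := by
  have hincl := extendByZero_apply_incl (β := β) W
  have hG : ∀ k l (i : Fin (2 * n k + cond (β k) 1 0)) (j : Fin (2 * n l + cond (β l) 1 0)),
      Matrix.blockDiagonal' (fun k => elimGram (n k) (β k) (y k))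
        ⟨k, circuitSplitEquiv (n k) (cond (β k) 1 0) (Sum.inl i)⟩
        ⟨l, circuitSplitEquiv (n l) (cond (β l) 1 0) (Sum.inl j)⟩ =
      if k = l then corrE (2 * n k) (y k) i.1 j.1 else 0 := by
    intro k l i j
    split_ifs with hkl
    · subst hkl
      rw [Matrix.blockDiagonal'_apply_eq, elimGram_vertex_vertex (hn k)]
    · exact Matrix.blockDiagonal'_apply_ne _ _ _ hkl
  ext (⟨k, i⟩ | s) (⟨l, j⟩ | t) <;> rw [Matrix.submatrix_apply, Matrix.add_apply]
  · rw [splitEquiv_inl_inl, splitEquiv_inl_inl, circuitsMatrix, Matrix.fromBlocks_apply₁₁, hG, bigM]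
    congr 1
    split_ifs with hi hj
    · rw [circuitSplitEquiv_inl_of_lt i hi, circuitSplitEquiv_inl_of_lt j hj]
      exact hincl (Sum.inl ⟨k, ⟨i.1, hi⟩⟩) (Sum.inl ⟨l, ⟨j.1, hj⟩⟩)
    · rw [circuitSplitEquiv_inl_of_not_lt j hj, extendByZero_apply_inner_right]
    · rw [circuitSplitEquiv_inl_of_not_lt i hi, extendByZero_apply_inner_left]
  · rw [splitEquiv_inl_inl, splitEquiv_inl_inr, circuitsMatrix, Matrix.fromBlocks_apply₁₂, bigM,
      Matrix.zero_apply, add_zero]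
    split_ifs with hi
    · rw [circuitSplitEquiv_inl_of_lt i hi]
      exact hincl (Sum.inl ⟨k, ⟨i.1, hi⟩⟩) (Sum.inr t)
    · rw [circuitSplitEquiv_inl_of_not_lt i hi, extendByZero_apply_inner_left]
  · rw [splitEquiv_inl_inl, splitEquiv_inl_inr, circuitsMatrix, Matrix.fromBlocks_apply₂₁, bigM,
      Matrix.zero_apply, add_zero]
    split_ifs with hj
    · rw [circuitSplitEquiv_inl_of_lt j hj]
      exact hincl (Sum.inr s) (Sum.inl ⟨l, ⟨j.1, hj⟩⟩)
    · rw [circuitSplitEquiv_inl_of_not_lt j hj, extendByZero_apply_inner_right]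
  · rw [splitEquiv_inl_inr, splitEquiv_inl_inr, circuitsMatrix, Matrix.fromBlocks_apply₂₂, bigM,
      Matrix.zero_apply, add_zero]
    exact hincl (Sum.inr s) (Sum.inr t)

theorem extendByZero_add_apply_pair
    (W : Matrix ((Σ k : Fin b, Fin (2 * n k)) ⊕ Fin m) ((Σ k : Fin b, Fin (2 * n k)) ⊕ Fin m) K)
    (G : ∀ k, Matrix (Fin (2 * n k) ⊕ Fin (2 * n k + cond (β k) 1 0))
      (Fin (2 * n k) ⊕ Fin (2 * n k + cond (β k) 1 0)) K)
    (k k' : Fin b) (u : Fin (2 * n k') ⊕ Fin (2 * n k' + cond (β k') 1 0)) (l : Fin (n k))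
    (a : Fin 2) :
    (extendByZero β W + circuitsMatrix n m β G 0) (Sum.inl ⟨k', u⟩)
      (splitEquiv n (fun k => cond (β k) 1 0) m (Sum.inr (⟨k, l⟩, a))) =
      Matrix.blockDiagonal' G ⟨k', u⟩
        ⟨k, circuitSplitEquiv (n k) (cond (β k) 1 0) (Sum.inr (l, a))⟩ := by
  rw [Matrix.add_apply, splitEquiv_inr, circuitSplitEquiv_inr, extendByZero_apply_inner_right,
    circuitsMatrix, Matrix.fromBlocks_apply₁₁, zero_add]

theorem even_sum_add (hβ : Even (Finset.univ.filter fun k => β k = true).card)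
    (hV : Even ((∑ k, 2 * n k) + m)) : Even (∑ k, (2 * n k + cond (β k) 1 0) + m) := by
  have h : ∑ k, cond (β k) 1 0 = (Finset.univ.filter fun k => β k = true).card := by
    rw [Finset.card_filter]
    exact Finset.sum_congr rfl fun k _ => by cases β k <;> rfl
  rw [Finset.sum_add_distrib, h, add_right_comm]
  exact hV.add hβ

theorem pf_reindex_bigA_of_field [CharZero K] (hn : ∀ k, 2 ≤ n k)
    (hβ : Even (Finset.univ.filter fun k => β k = true).card) (hV : Even ((∑ k, 2 * n k) + m))
    (W : Matrix ((Σ k : Fin b, Fin (2 * n k)) ⊕ Fin m) ((Σ k : Fin b, Fin (2 * n k)) ⊕ Fin m) K)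
    (hW : Wᵀ = -W) (y : (k : Fin b) → Fin (2 * n k) → K) :
    pf (Matrix.reindex (bigEquiv n (fun k => cond (β k) 1 0) m)
        (bigEquiv n (fun k => cond (β k) 1 0) m) (bigA b m (fun k => 2 * n k) β y W)) =
      (∏ k, (-1) ^ n k * cond (β k) (2 * n k : K) 2) *
        pf (Matrix.reindex (blocksEquiv (fun k => 2 * n k + cond (β k) 1 0) m)
          (blocksEquiv (fun k => 2 * n k + cond (β k) 1 0) m)
          (bigM b m (fun k => 2 * n k) β y W)) := by
  set e := bigEquiv n (fun k => cond (β k) 1 0) m with he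
  set A := bigA b m (fun k => 2 * n k) β y W with hA
  set C := elimGlobal n m β y with hC
  have hp := even_sum_add hβ hV
  have hm : Even (∑ k, (2 * n k + (2 * n k + cond (β k) 1 0)) + m) := by
    rw [Finset.sum_add_distrib, add_assoc]
    refine Even.add ?_ hp
    rw [← Finset.mul_sum]
    exact even_two_mul _
  have hAt : Aᵀ = -A := bigA_antisymm W hn hW y
  have hanti : ∀ i j, A i j = -A j i := apply_eq_neg_of_transpose_eq_neg hAt
  have hcongr := pf_congruence hm (Matrix.reindex e e C) (Matrix.reindex e e A)
    fun i j => hanti _ _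
  have hmul : Matrix.reindex e e C * Matrix.reindex e e A * (Matrix.reindex e e C)ᵀ =
      Matrix.reindex e e (C * A * Cᵀ) := by
    simp [Matrix.reindex_apply, Matrix.submatrix_mul_equiv, Matrix.transpose_submatrix]
  have hDt : (C * A * Cᵀ)ᵀ = -(C * A * Cᵀ) := by
    simp [Matrix.transpose_mul, hAt, Matrix.mul_assoc]
  have hDanti : ∀ i j, (C * A * Cᵀ) i j = -(C * A * Cᵀ) j i :=
    apply_eq_neg_of_transpose_eq_neg hDt
  have hD : C * A * Cᵀ = extendByZero β W +
      circuitsMatrix n m β (fun k => elimGram (n k) (β k) (y k)) 0 := elimGlobal_mul_bigA_mul W y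
  rw [hmul, Matrix.det_reindex_self, pf_reindex_bigEquiv n _ m hp _ hDanti, hD,
    submatrix_splitEquiv_inl hn W y] at hcongr
  · have hdet : C.det ≠ 0 := by
      rw [hC, det_elimGlobal, Finset.prod_ne_zero_iff]
      intro k _
      rw [det_elimMatrix (hn k)]
      cases β k <;> simp
    refine mul_left_cancel₀ hdet (hcongr.symm.trans ?_)
    rw [← mul_assoc, hC, det_elimGlobal, ← Finset.prod_mul_distrib]
    congr 1
    refine Finset.prod_congr rfl fun k _ => ?_
    rw [← prod_elimGram_pair (hn k)]
    refine Finset.prod_congr rfl fun l _ => ?_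
    rw [splitEquiv_inr _ _ _ k l 0, extendByZero_add_apply_pair, Matrix.blockDiagonal'_apply_eq]
  · rintro (⟨k', i⟩ | t) k l
    · rw [hD, splitEquiv_inl_inl, extendByZero_add_apply_pair]
      by_cases hk : k' = k
      · subst hk
        rw [Matrix.blockDiagonal'_apply_eq, elimGram_vertex_pair (hn k')]
      · exact Matrix.blockDiagonal'_apply_ne _ _ _ hk
    · rw [hD, splitEquiv_inl_inr, Matrix.add_apply, splitEquiv_inr, circuitSplitEquiv_inr,
        extendByZero_apply_inner_right, circuitsMatrix, Matrix.fromBlocks_apply₂₁,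
        Matrix.zero_apply, add_zero]
  · intro k l l' a h
    rw [hD, splitEquiv_inr _ _ _ k l' a, extendByZero_add_apply_pair,
      Matrix.blockDiagonal'_apply_eq, elimGram_pair_pair (hn k) (y k) h]
  · intro k k' l l' a h
    rw [hD, splitEquiv_inr _ _ _ k' l' a, extendByZero_add_apply_pair]
    exact Matrix.blockDiagonal'_apply_ne _ _ _ h

end FieldCase

section RingTransfer

variable {R S : Type*} [CommRing R] [CommRing S]

theorem map_pf (φ : R →+* S) {m : ℕ} (A : Matrix (Fin m) (Fin m) R) :
    φ (pf A) = pf (A.map φ) := by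
  simp only [pf, map_sum, map_zsmul, map_prod, Matrix.map_apply]

theorem pf_submatrix_congr_of_ne {m : ℕ} {ι : Type*} {A B : Matrix ι ι R}
    (h : ∀ i j, i ≠ j → A i j = B i j) (e : Fin m ≃ ι) :
    pf (A.submatrix e e) = pf (B.submatrix e e) := by
  refine Finset.sum_congr rfl fun σ hσ => ?_
  congr 1
  exact Finset.prod_congr rfl fun k _ =>
    h _ _ (e.injective.ne ((Finset.mem_filter.mp hσ).2.1 k).ne)

theorem map_AblkE (φ : R →+* S) (N : ℕ) (c : Bool) (y : Fin N → R) (i j : ℕ) :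
    φ (AblkE N c y i j) = AblkE N c (fun i => φ (y i)) i j := by
  unfold AblkE
  split_ifs <;> cases c <;> simp

theorem map_BblkE (φ : R →+* S) (N : ℕ) (c : Bool) (i j : ℕ) :
    φ (BblkE N c i j) = BblkE N c i j := by
  unfold BblkE
  split_ifs <;> cases c <;> simp

theorem map_corrE (φ : R →+* S) (N : ℕ) (y : Fin N → R) (i j : ℕ) :
    φ (corrE N y i j) = corrE N (fun i => φ (y i)) i j := by
  unfold corrE vW
  split_ifs <;> simp

variable {b m : ℕ} {N : Fin b → ℕ} {β : Fin b → Bool}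

theorem map_bigA (φ : R →+* S) (y : (k : Fin b) → Fin (N k) → R)
    (W : Matrix ((Σ k : Fin b, Fin (N k)) ⊕ Fin m) ((Σ k : Fin b, Fin (N k)) ⊕ Fin m) R) :
    (bigA b m N β y W).map φ = bigA b m N β (fun k i => φ (y k i)) (W.map φ) := by
  ext (⟨k, i | i⟩ | s) (⟨l, j | j⟩ | t) <;> simp only [Matrix.map_apply, bigA, map_zero] <;>
    split_ifs <;> simp only [map_neg, map_zero, map_AblkE, map_BblkE]

theorem map_bigM (φ : R →+* S) (y : (k : Fin b) → Fin (N k) → R)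
    (W : Matrix ((Σ k : Fin b, Fin (N k)) ⊕ Fin m) ((Σ k : Fin b, Fin (N k)) ⊕ Fin m) R) :
    (bigM b m N β y W).map φ = bigM b m N β (fun k i => φ (y k i)) (W.map φ) := by
  ext (⟨k, i⟩ | s) (⟨l, j⟩ | t) <;> simp only [Matrix.map_apply, bigM, map_add] <;>
    split_ifs <;> simp only [map_zero, map_corrE]

theorem bigA_congr_of_ne {y : (k : Fin b) → Fin (N k) → R}
    {W W' : Matrix ((Σ k : Fin b, Fin (N k)) ⊕ Fin m) ((Σ k : Fin b, Fin (N k)) ⊕ Fin m) R}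
    (h : ∀ p q, p ≠ q → W p q = W' p q) (p q) (hpq : p ≠ q) :
    bigA b m N β y W p q = bigA b m N β y W' p q := by
  rcases p with ⟨k, i | i⟩ | s <;> rcases q with ⟨l, j | j⟩ | t <;> try rfl
  · refine h _ _ fun h' => hpq ?_
    simp only [Sum.inl.injEq, Sigma.mk.injEq] at h'
    obtain ⟨rfl, h'⟩ := h'
    rw [eq_of_heq h']
  · exact h _ _ (by simp)
  · exact h _ _ (by simp)
  · exact h _ _ (by simpa using hpq)

theorem bigM_congr_of_ne {y : (k : Fin b) → Fin (N k) → R}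
    {W W' : Matrix ((Σ k : Fin b, Fin (N k)) ⊕ Fin m) ((Σ k : Fin b, Fin (N k)) ⊕ Fin m) R}
    (h : ∀ p q, p ≠ q → W p q = W' p q) (p q) (hpq : p ≠ q) :
    bigM b m N β y W p q = bigM b m N β y W' p q := by
  rcases p with ⟨k, i⟩ | s <;> rcases q with ⟨l, j⟩ | t <;> simp only [bigM]
  · congr 1
    split_ifs with hi hj <;> try rfl
    refine h _ _ fun h' => hpq ?_
    simp only [Sum.inl.injEq, Sigma.mk.injEq] at h'
    obtain ⟨rfl, h'⟩ := h'
    have hv := congrArg Fin.val (eq_of_heq h')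
    obtain rfl : i = j := Fin.ext hv
    rfl
  · split_ifs with hi <;> first | rfl | exact h _ _ (by simp)
  · split_ifs with hi <;> first | rfl | exact h _ _ (by simp)
  · exact h _ _ (by simpa using hpq)

/-- A skew-symmetric matrix lifts to a skew-symmetric matrix along a surjection, up to its
diagonal. -/
theorem exists_skew_lift (φ : S →+* R) (hφ : Function.Surjective φ) {ι κ : Type*} [LinearOrder κ]
    {e : ι → κ} (he : Function.Injective e) (W : Matrix ι ι R) (hW : Wᵀ = -W) :
    ∃ W' : Matrix ι ι S, W'ᵀ = -W' ∧ ∀ p q, p ≠ q → W p q = W'.map φ p q := by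
  choose g hg using hφ
  refine ⟨Matrix.of fun p q =>
    if e p < e q then g (W p q) else if e q < e p then -g (W q p) else 0, ?_, fun p q hpq => ?_⟩
  · ext p q
    rcases lt_trichotomy (e p) (e q) with h | h | h
    · simp [h, h.not_gt]
    · simp [h]
    · simp [h, h.not_gt]
  · rcases lt_trichotomy (e p) (e q) with h | h | h
    · simp [h, hg]
    · exact absurd (he h) hpq
    · simp [h, h.not_gt, hg, ← apply_eq_neg_of_transpose_eq_neg hW]

end RingTransfer

section GeneralRing

variable {b : ℕ} {n : Fin b → ℕ} {m : ℕ} {β : Fin b → Bool}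

theorem pf_reindex_bigA_of_isDomain {S : Type*} [CommRing S] [IsDomain S] [CharZero S]
    (hn : ∀ k, 2 ≤ n k)
    (hβ : Even (Finset.univ.filter fun k => β k = true).card) (hV : Even ((∑ k, 2 * n k) + m))
    (W : Matrix ((Σ k : Fin b, Fin (2 * n k)) ⊕ Fin m) ((Σ k : Fin b, Fin (2 * n k)) ⊕ Fin m) S)
    (hW : Wᵀ = -W) (y : (k : Fin b) → Fin (2 * n k) → S) :
    pf (Matrix.reindex (bigEquiv n (fun k => cond (β k) 1 0) m)
        (bigEquiv n (fun k => cond (β k) 1 0) m) (bigA b m (fun k => 2 * n k) β y W)) =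
      (∏ k, (-1) ^ n k * cond (β k) (2 * n k : S) 2) *
        pf (Matrix.reindex (blocksEquiv (fun k => 2 * n k + cond (β k) 1 0) m)
          (blocksEquiv (fun k => 2 * n k + cond (β k) 1 0) m)
          (bigM b m (fun k => 2 * n k) β y W)) := by
  have hinj := IsFractionRing.injective S (FractionRing S)
  have : CharZero (FractionRing S) := charZero_of_injective_algebraMap hinj
  apply hinj
  have h := pf_reindex_bigA_of_field hn hβ hV (W.map (algebraMap S (FractionRing S)))
    (by rw [← Matrix.transpose_map, hW]; ext; simp) (fun k i => algebraMap S _ (y k i))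
  rw [map_mul, map_pf, map_pf, Matrix.reindex_apply, Matrix.reindex_apply, ← Matrix.submatrix_map,
    ← Matrix.submatrix_map, map_bigA, map_bigM, map_prod]
  refine h.trans ?_
  congr 1
  refine Finset.prod_congr rfl fun k _ => ?_
  cases β k <;> simp [map_ofNat]

theorem pf_reindex_bigA {R : Type*} [CommRing R] (hn : ∀ k, 2 ≤ n k)
    (hβ : Even (Finset.univ.filter fun k => β k = true).card) (hV : Even ((∑ k, 2 * n k) + m))
    (W : Matrix ((Σ k : Fin b, Fin (2 * n k)) ⊕ Fin m) ((Σ k : Fin b, Fin (2 * n k)) ⊕ Fin m) R)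
    (hW : Wᵀ = -W) (y : (k : Fin b) → Fin (2 * n k) → R) :
    pf (Matrix.reindex (bigEquiv n (fun k => cond (β k) 1 0) m)
        (bigEquiv n (fun k => cond (β k) 1 0) m) (bigA b m (fun k => 2 * n k) β y W)) =
      (∏ k, (-1) ^ n k * cond (β k) (2 * n k : R) 2) *
        pf (Matrix.reindex (blocksEquiv (fun k => 2 * n k + cond (β k) 1 0) m)
          (blocksEquiv (fun k => 2 * n k + cond (β k) 1 0) m)
          (bigM b m (fun k => 2 * n k) β y W)) := by
  set φ : MvPolynomial R ℤ →+* R := MvPolynomial.eval₂Hom (Int.castRingHom R) id with hφ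
  have hX : ∀ r : R, φ (MvPolynomial.X r) = r := fun r => by simp [hφ]
  obtain ⟨W', hW', hWW'⟩ := exists_skew_lift φ (fun r => ⟨_, hX r⟩)
    (blocksEquiv (fun k => 2 * n k) m).injective W hW
  have h := congrArg φ (pf_reindex_bigA_of_isDomain hn hβ hV W' hW'
    fun k i => MvPolynomial.X (y k i))
  rw [map_mul, map_pf, map_pf, Matrix.reindex_apply, Matrix.reindex_apply, ← Matrix.submatrix_map,
    ← Matrix.submatrix_map, map_bigA, map_bigM, map_prod] at h
  simp only [hX] at h
  rw [Matrix.reindex_apply, Matrix.reindex_apply,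
    pf_submatrix_congr_of_ne (bigA_congr_of_ne hWW'),
    pf_submatrix_congr_of_ne (bigM_congr_of_ne hWW'), h]
  congr 1
  refine Finset.prod_congr rfl fun k _ => ?_
  cases β k <;> simp [map_ofNat φ]

theorem prod_neg_one_pow_mul_cond {R : Type*} [CommRing R] (n : Fin b → ℕ) (β : Fin b → Bool) :
    ∏ k, (-1) ^ n k * cond (β k) (2 * n k : R) 2 =
      (-1 : R) ^ (∑ k, n k) * 2 ^ (Finset.univ.filter fun k => β k = false).card *
        ∏ k ∈ Finset.univ.filter fun k => β k = true, ((2 * n k : ℕ) : R) := by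
  rw [Finset.prod_mul_distrib, Finset.prod_pow_eq_pow_sum, mul_assoc, ← Finset.prod_const,
    Finset.prod_filter, Finset.prod_filter, ← Finset.prod_mul_distrib]
  congr 1
  refine Finset.prod_congr rfl fun k _ => ?_
  cases β k <;> simp

end GeneralRing

/-- **Matrix form of Proposition 3.3**: for `b ≥ 1`, `β ∈ {0,1}^b` with `∑ β_k` even,
even circuit lengths `N_k = 2 n_k ≥ 4`, an interior of size `m` with
`V = ∑ N_k + m` even, circuit weights `y^k`, and an arbitrary skew-symmetric `V × V`
matrix `W`, one has
`Pf(A_β) = (-1)^{∑ n_k} ⬝ 2^{#{k : β_k = 0}} ⬝ (∏_{k : β_k = 1} N_k) ⬝ Pf(M_β)`. -/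
theorem pf_bigA_eq_pf_bigM {R : Type*} [CommRing R] (b : ℕ) (hb : 1 ≤ b)
    (β : Fin b → Bool) (hβ : Even (Finset.univ.filter fun k => β k = true).card)
    (n : Fin b → ℕ) (hn : ∀ k, 2 ≤ n k) (m : ℕ)
    (hV : Even ((∑ k, 2 * n k) + m))
    (y : (k : Fin b) → Fin (2 * n k) → R)
    (W : Matrix ((Σ k : Fin b, Fin (2 * n k)) ⊕ Fin m)
                ((Σ k : Fin b, Fin (2 * n k)) ⊕ Fin m) R)
    (hW : Wᵀ = -W) :
    pf (Matrix.reindex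
        ((Equiv.sumCongr
            ((Equiv.sigmaCongrRight fun k : Fin b =>
                (finSumFinEquiv :
                  Fin (2 * n k) ⊕ Fin (2 * n k + cond (β k) 1 0) ≃ _)).trans
              (mySigmaEquiv fun k => 2 * n k + (2 * n k + cond (β k) 1 0)))
            (Equiv.refl (Fin m))).trans finSumFinEquiv)
        ((Equiv.sumCongr
            ((Equiv.sigmaCongrRight fun k : Fin b =>
                (finSumFinEquiv :
                  Fin (2 * n k) ⊕ Fin (2 * n k + cond (β k) 1 0) ≃ _)).trans
              (mySigmaEquiv fun k => 2 * n k + (2 * n k + cond (β k) 1 0)))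
            (Equiv.refl (Fin m))).trans finSumFinEquiv)
        (bigA b m (fun k => 2 * n k) β y W)) =
      (-1 : R) ^ (∑ k, n k) *
        2 ^ (Finset.univ.filter fun k => β k = false).card *
        (∏ k ∈ Finset.univ.filter fun k => β k = true, ((2 * n k : ℕ) : R)) *
        pf (Matrix.reindex
          ((Equiv.sumCongr (mySigmaEquiv fun k => 2 * n k + cond (β k) 1 0)
            (Equiv.refl (Fin m))).trans finSumFinEquiv)
          ((Equiv.sumCongr (mySigmaEquiv fun k => 2 * n k + cond (β k) 1 0)
            (Equiv.refl (Fin m))).trans finSumFinEquiv)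
          (bigM b m (fun k => 2 * n k) β y W)) := by
  rw [← prod_neg_one_pow_mul_cond]
  exact pf_reindex_bigA hn hβ hV W hW y
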